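/- arXiv:1312.1234 — 2 statements merged into one kernel-verified Lean document; each statement's English description precedes it below -/
import Mathlib

section
/- Every finite tree with at least one edge that is not a pseudopath has an irreplaceable end-edge. -/
open SimpleGraph

namespace ErnPaper

/-- The weight of a vertex `v` in a graph `G`: the number of vertices in a largest
connected component of `G - v`. -/
noncomputable def wt {V : Type} [Fintype V] (G : SimpleGraph V) (v : V) : ℕ :=
  sSup {n | ∃ c : (G.induce ({v}ᶜ : Set V)).ConnectedComponent, n = Nat.card c.supp}

/-- The centroid of a graph: the set of vertices of minimum weight. -/
def centroid {V : Type} [Fintype V] (G : SimpleGraph V) : Set V :=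
  {v | ∀ u, wt G v ≤ wt G u}

/-- The edge-reconstruction number of a finite graph `G`: the least `k` for which there exist
`k` distinct edges `e₁, …, e_k` of `G` such that any finite graph `H` having `k` distinct
edges `f₁, …, f_k` with `H - fᵢ ≅ G - eᵢ` for all `i` must be isomorphic to `G`. -/
noncomputable def ern {V : Type} [Fintype V] (G : SimpleGraph V) : ℕ :=
  sInf {k | ∃ s : Finset (Sym2 V), s.card = k ∧ (↑s : Set (Sym2 V)) ⊆ G.edgeSet ∧
    ∀ (W : Type) (_ : Fintype W) (H : SimpleGraph W) (t : Finset (Sym2 W)),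
      (↑t : Set (Sym2 W)) ⊆ H.edgeSet →
      (∃ φ : {e // e ∈ s} ≃ {f // f ∈ t},
        ∀ e : {e // e ∈ s},
          Nonempty (H.deleteEdges {(φ e).1} ≃g G.deleteEdges {e.1})) →
      Nonempty (H ≃g G)}

/-- The spider tree `S_{p,q,r}`: three paths with `p`, `q`, `r` edges respectively,
emanating from a common central vertex. -/
def spider (p q r : ℕ) : SimpleGraph (Unit ⊕ (Fin p ⊕ Fin q ⊕ Fin r)) :=
  SimpleGraph.fromRel fun x y =>
    match x, y with
    | Sum.inl _, Sum.inr (Sum.inl j) => (j : ℕ) = 0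
    | Sum.inl _, Sum.inr (Sum.inr (Sum.inl j)) => (j : ℕ) = 0
    | Sum.inl _, Sum.inr (Sum.inr (Sum.inr j)) => (j : ℕ) = 0
    | Sum.inr (Sum.inl i), Sum.inr (Sum.inl j) => (j : ℕ) = (i : ℕ) + 1
    | Sum.inr (Sum.inr (Sum.inl i)), Sum.inr (Sum.inr (Sum.inl j)) => (j : ℕ) = (i : ℕ) + 1
    | Sum.inr (Sum.inr (Sum.inr i)), Sum.inr (Sum.inr (Sum.inr j)) => (j : ℕ) = (i : ℕ) + 1
    | _, _ => False

/-- A pseudopath: a tree isomorphic to a path `P_k`, to `S_{1,1,2}`, or to `S_{1,2,3}`. -/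
def IsPseudopath {V : Type} (T : SimpleGraph V) : Prop :=
  (∃ k, Nonempty (T ≃g pathGraph k)) ∨
    Nonempty (T ≃g spider 1 1 2) ∨ Nonempty (T ≃g spider 1 2 3)

/-- `T - xv + yv`: delete the end-edge `xv` and add the new edge `yv`. -/
def replaceEdge {V : Type} (T : SimpleGraph V) (x v y : V) : SimpleGraph V :=
  SimpleGraph.fromEdgeSet ((T.edgeSet \ {s(x, v)}) ∪ {s(y, v)})

/-- The disjoint union of two simple graphs. -/
def disjUnion {α β : Type} (G : SimpleGraph α) (H : SimpleGraph β) :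
    SimpleGraph (α ⊕ β) :=
  SimpleGraph.fromRel fun x y =>
    match x, y with
    | Sum.inl a, Sum.inl b => G.Adj a b
    | Sum.inr a, Sum.inr b => H.Adj a b
    | _, _ => False

/-- The caterpillar `C(2,0,…,0,2)` with spine on `m` vertices: spine path `v₀ … v_{m-1}`,
with two extra endvertices adjacent to `v₀` and two to `v_{m-1}`. -/
def doubleBroom (m : ℕ) : SimpleGraph (Fin m ⊕ Fin 4) :=
  SimpleGraph.fromRel fun x y =>
    match x, y with
    | Sum.inl i, Sum.inl j => (j : ℕ) = (i : ℕ) + 1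
    | Sum.inl i, Sum.inr l =>
        ((i : ℕ) = 0 ∧ (l : ℕ) < 2) ∨ ((i : ℕ) = m - 1 ∧ 2 ≤ (l : ℕ))
    | _, _ => False


/-! ### Codes of rooted trees -/

/-- Code of a rooted tree, given the multiset of codes of the branches at the root. -/
def szc (a : ℕ) : ℕ :=
  match (Encodable.decode a : Option (ℕ × Multiset ℕ)) with
  | some s => s.1
  | none => 0

def chc (a : ℕ) : Multiset ℕ :=
  match (Encodable.decode a : Option (ℕ × Multiset ℕ)) with
  | some s => s.2
  | none => 0

def node (M : Multiset ℕ) : ℕ := Encodable.encode ((M.map szc).sum + 1, M)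

lemma sz_node (M : Multiset ℕ) : szc (node M) = (M.map szc).sum + 1 := by
  simp [szc, node]

lemma ch_node (M : Multiset ℕ) : chc (node M) = M := by
  simp [chc, node]

lemma node_inj {M N : Multiset ℕ} : node M = node N ↔ M = N :=
  ⟨fun h => by rw [← ch_node M, h, ch_node], fun h => by rw [h]⟩

/-- `Del a b`: the rooted tree `b` is obtained from `a` by deleting a non-root leaf. -/
inductive Del : ℕ → ℕ → Prop
  | leaf (a b : ℕ) (M : Multiset ℕ) : a = node (node 0 ::ₘ M) → b = node M → Del a b
  | step (a b e e' : ℕ) (M : Multiset ℕ) : a = node (e ::ₘ M) → b = node (e' ::ₘ M) →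
      Del e e' → Del a b

lemma Del.sz {a b : ℕ} (h : Del a b) : szc a = szc b + 1 := by
  induction h with
  | leaf a b M ha hb => subst ha hb; simp [sz_node]; omega
  | step a b e e' M ha hb _ ih => subst ha hb; simp [sz_node, ih]; omega

lemma Del.up_inv {b a : ℕ} (h : Del (node {b}) a) :
    (b = node 0 ∧ a = node 0) ∨ ∃ b', Del b b' ∧ a = node {b'} := by
  cases h with
  | leaf _ _ M ha hb =>
    rw [node_inj, Multiset.singleton_eq_cons_iff] at ha
    obtain ⟨h1, rfl⟩ := ha
    exact Or.inl ⟨h1, hb⟩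
  | step _ _ e e' M ha hb h =>
    rw [node_inj, Multiset.singleton_eq_cons_iff] at ha
    obtain ⟨rfl, rfl⟩ := ha
    exact Or.inr ⟨e', h, by simpa using hb⟩

/-- Codes of paths rooted at an end. -/
inductive IsPC : ℕ → Prop
  | leaf (a : ℕ) : a = node 0 → IsPC a
  | up (a b : ℕ) : a = node {b} → IsPC b → IsPC a

lemma IsPC.of_up {a : ℕ} (h : IsPC (node {a})) : IsPC a := by
  cases h with
  | leaf _ h => rw [node_inj] at h; simp at h
  | up _ b h hb =>
    rw [node_inj, Multiset.singleton_inj] at h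
    exact h ▸ hb

lemma path_lemma {a a' : ℕ} (h : Del a a') : ∀ b b', Del b b' → node {a'} = b → node {b'} = a →
    IsPC a ∧ IsPC b := by
  induction h with
  | leaf a a' M ha ha' =>
    intro b b' hb h1 h2
    rw [ha, node_inj, Multiset.singleton_eq_cons_iff] at h2
    obtain ⟨h2, rfl⟩ := h2
    refine ⟨.up _ (node 0) (by simpa using ha) (.leaf _ rfl), ?_⟩
    exact .up _ (node 0) (by rw [← h1, ha']) (.leaf _ rfl)
  | step a a' e e' M ha ha' he ih =>
    intro b b' hb h1 h2
    rw [ha, node_inj, Multiset.singleton_eq_cons_iff] at h2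
    obtain ⟨h2, rfl⟩ := h2
    subst h2
    have ha1 : a' = node {e'} := by simpa using ha'
    rw [← h1] at hb
    rcases hb.up_inv with ⟨h3, _⟩ | ⟨f, hf, h3⟩
    · rw [ha1, node_inj] at h3; simp at h3
    · have := ih a' f hf ha1.symm h3.symm
      exact ⟨.up _ b' (by simpa using ha) this.1, .up _ a' h1.symm this.2⟩

lemma path_self {a : ℕ} (h : Del (node {a}) a) : IsPC a :=
  (path_lemma h _ _ h rfl rfl).1.of_up

lemma IsPC.sz_pos {a : ℕ} (h : IsPC a) : 1 ≤ szc a := by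
  cases h with
  | leaf _ h => subst h; simp [sz_node]
  | up _ b h hb => subst h; simp [sz_node]

/-! ### Codes of branches of a graph -/

open Classical in
noncomputable def kids {V : Type} [Fintype V] (G : SimpleGraph V) (p u : V) : Finset V :=
  Finset.univ.filter (fun w => G.Adj u w ∧ w ≠ p)

lemma mem_kids {V : Type} [Fintype V] {G : SimpleGraph V} {p u w : V} :
    w ∈ kids G p u ↔ G.Adj u w ∧ w ≠ p := by simp [kids]

noncomputable def codeN {V : Type} [Fintype V] (G : SimpleGraph V) : ℕ → V → V → ℕ
  | 0, _, _ => node 0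
  | k + 1, p, u => node ((kids G p u).val.map (codeN G k u))

noncomputable def code {V : Type} [Fintype V] (G : SimpleGraph V) (p u : V) : ℕ :=
  codeN G (Fintype.card V) p u

lemma cons_path {V : Type} {G : SimpleGraph V} (hG : G.IsAcyclic) {p u w z : V} (h : G.Adj p u)
    (h' : G.Adj u w) (hw : w ≠ p) (q : G.Walk w z) (hq : (Walk.cons h' q).IsPath) :
    (Walk.cons h (Walk.cons h' q)).IsPath := by
  classical
  rw [Walk.cons_isPath_iff]
  refine ⟨hq, fun hp => ?_⟩
  have h1 : ((Walk.cons h' q).takeUntil p hp).IsPath := hq.takeUntil hp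
  have h2 : (Walk.cons h.symm Walk.nil : G.Walk u p).IsPath := by
    simp [Walk.cons_isPath_iff, h.ne']
  have h3 := hG.path_unique ⟨_, h1⟩ ⟨_, h2⟩
  have h4 : (Walk.cons h' q).takeUntil p hp = Walk.cons h.symm Walk.nil := congrArg Subtype.val h3
  rw [Walk.takeUntil_cons (by
    rw [Walk.support_cons] at hp
    simpa [h.ne] using hp) h.ne'] at h4
  have := congrArg Walk.snd h4
  simp at this
  exact hw this

lemma codeN_path {V : Type} [Fintype V] {G : SimpleGraph V} (hG : G.IsAcyclic) (k : ℕ) :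
    ∀ p u (h : G.Adj p u), codeN G k p u ≠ codeN G (k + 1) p u →
      ∃ z, ∃ q : G.Walk u z, (Walk.cons h q).IsPath ∧ k + 1 ≤ q.length := by
  induction k with
  | zero =>
    intro p u h hne
    have : (kids G p u).Nonempty := by
      by_contra hc
      rw [Finset.not_nonempty_iff_eq_empty] at hc
      apply hne
      simp [codeN, hc]
    obtain ⟨w, hw⟩ := this
    rw [mem_kids] at hw
    refine ⟨w, Walk.cons hw.1 Walk.nil, ?_, by simp⟩
    exact cons_path hG _ _ hw.2 _ (by simp [Walk.cons_isPath_iff, hw.1.ne])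
  | succ k ih =>
    intro p u h hne
    have : ∃ w ∈ kids G p u, codeN G k u w ≠ codeN G (k + 1) u w := by
      by_contra! hc
      apply hne
      rw [codeN, codeN, node_inj]
      exact Multiset.map_congr rfl (fun w hw => hc w hw)
    obtain ⟨w, hw, hne'⟩ := this
    rw [mem_kids] at hw
    obtain ⟨z, q, hq, hl⟩ := ih u w hw.1 hne'
    exact ⟨z, Walk.cons hw.1 q, cons_path hG _ _ hw.2 _ hq, by simpa using hl⟩

lemma code_eq {V : Type} [Fintype V] {G : SimpleGraph V} (hG : G.IsAcyclic) (p u : V) :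
    code G p u = node ((kids G p u).val.map (code G u)) := by
  classical
  have : 0 < Fintype.card V := Fintype.card_pos_iff.2 ⟨u⟩
  obtain ⟨k, hk⟩ : ∃ k, Fintype.card V = k + 1 := ⟨Fintype.card V - 1, by omega⟩
  have h1 : code G p u = node ((kids G p u).val.map (codeN G k u)) := by
    rw [code, hk, codeN]
  rw [h1, node_inj]
  refine Multiset.map_congr rfl (fun w hw => ?_)
  have hw' : w ∈ kids G p u := hw
  rw [mem_kids] at hw'
  rw [code, hk]
  by_contra hne
  obtain ⟨z, q, hq, hl⟩ := codeN_path hG k u w hw'.1 hne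
  have := hq.length_lt
  simp at this
  omega

lemma ch_code {V : Type} [Fintype V] {G : SimpleGraph V} (hG : G.IsAcyclic) (p u : V) :
    chc (code G p u) = (kids G p u).val.map (code G u) := by
  rw [code_eq hG, ch_node]

lemma node_ch {V : Type} [Fintype V] {G : SimpleGraph V} (hG : G.IsAcyclic) (p u : V) :
    node (chc (code G p u)) = code G p u := by
  rw [code_eq hG, ch_node]

lemma sz_pos {V : Type} [Fintype V] {G : SimpleGraph V} (hG : G.IsAcyclic) (p u : V) :
    1 ≤ szc (code G p u) := by
  rw [code_eq hG, sz_node]; omega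

lemma code_iso {V W : Type} [Fintype V] [Fintype W] {G : SimpleGraph V} {G' : SimpleGraph W}
    (φ : G' ≃g G) (p u : W) : code G' p u = code G (φ p) (φ u) := by
  classical
  have key : ∀ k, ∀ p u, codeN G' k p u = codeN G k (φ p) (φ u) := by
    intro k
    induction k with
    | zero => intros; rfl
    | succ k ih =>
      intro p u
      rw [codeN, codeN, node_inj]
      have : kids G (φ p) (φ u) = (kids G' p u).map φ.toEquiv.toEmbedding := by
        ext w
        obtain ⟨w, rfl⟩ := φ.surjective w
        simp only [mem_kids, Finset.mem_map_equiv, φ.map_adj_iff, ne_eq]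
        have e : φ.toEquiv.symm (φ w) = w := φ.symm_apply_apply w
        rw [e, φ.injective.eq_iff]
      rw [this, Finset.map_val, Multiset.map_map]
      exact Multiset.map_congr rfl (fun w _ => ih u w)
  rw [code, code, Fintype.card_congr φ.toEquiv, key]

lemma sz_kid {V : Type} [Fintype V] {G : SimpleGraph V} (hG : G.IsAcyclic) {p u w : V}
    (hw : w ∈ kids G p u) : szc (code G u w) < szc (code G p u) := by
  rw [code_eq hG p u, sz_node, Multiset.map_map]
  have : (szc ∘ code G u) w ≤ ((kids G p u).val.map (szc ∘ code G u)).sum :=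
    Multiset.single_le_sum (by simp) _ (Multiset.mem_map_of_mem _ hw)
  simp only [Function.comp] at this ⊢
  omega

lemma kid_ind {V : Type} [Fintype V] {G : SimpleGraph V} (hG : G.IsAcyclic) (P : V → V → Prop)
    (h : ∀ p u, (∀ w ∈ kids G p u, P u w) → P p u) (p u : V) : P p u := by
  have : ∀ n, ∀ p u, szc (code G p u) ≤ n → P p u := by
    intro n
    induction n with
    | zero => intro p u hn; have := sz_pos hG p u; omega
    | succ n ih =>
      intro p u hn
      exact h p u (fun w hw => ih u w (by have := sz_kid hG hw; omega))
  exact this _ p u le_rfl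

/-! ### Branches -/

/-- `Br G p u z`: the vertex `z` lies in the branch at `u` away from `p`. -/
inductive Br {V : Type} (G : SimpleGraph V) : V → V → V → Prop
  | root (p u : V) : Br G p u u
  | step (p u w z : V) : G.Adj u w → w ≠ p → Br G u w z → Br G p u z

lemma Br.path {V : Type} {G : SimpleGraph V} (hG : G.IsAcyclic) {p u z : V} (h : Br G p u z) :
    ∀ hpu : G.Adj p u, ∃ q : G.Walk u z, (Walk.cons hpu q).IsPath := by
  induction h with
  | root p u => intro h; exact ⟨Walk.nil, by simp [Walk.cons_isPath_iff, h.ne]⟩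
  | step p u w z h hw _ ih =>
    intro hpu
    obtain ⟨q, hq⟩ := ih h
    exact ⟨_, cons_path hG hpu h hw q hq⟩

lemma Br.disj {V : Type} {G : SimpleGraph V} (hG : G.IsAcyclic) {u w w' z : V} (h : Br G u w z)
    (h' : Br G u w' z) (hw : G.Adj u w) (hw' : G.Adj u w') : w = w' := by
  obtain ⟨q, hq⟩ := h.path hG hw
  obtain ⟨q', hq'⟩ := h'.path hG hw'
  have := congrArg (fun r => Walk.snd r.1) (hG.path_unique ⟨_, hq⟩ ⟨_, hq'⟩)
  simpa using this

lemma Br.not_self {V : Type} {G : SimpleGraph V} (hG : G.IsAcyclic) {u w : V}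
    (hw : G.Adj u w) : ¬ Br G u w u := by
  intro h
  obtain ⟨q, hq⟩ := h.path hG hw
  rw [Walk.cons_isPath_iff] at hq
  exact hq.2 (Walk.end_mem_support q)

lemma Br.disj2 {V : Type} {G : SimpleGraph V} (hG : G.IsAcyclic) {u p z : V} (h : Br G p u z)
    (hw : G.Adj p u) : ¬ Br G u p z := by
  intro h'
  cases h' with
  | root => exact Br.not_self hG hw h
  | step _ _ w _ h1 h2 h3 => exact h2 (h3.disj hG h h1 hw)

lemma Br.split {V : Type} {G : SimpleGraph V} {c b z : V} (h : Br G c c z) :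
    Br G b c z ∨ Br G c b z := by
  cases h with
  | root => exact Or.inl (.root _ _)
  | step _ _ w _ h1 h2 h3 =>
    by_cases hb : w = b
    · subst hb; exact Or.inr h3
    · exact Or.inl (.step _ _ w _ h1 hb h3)

lemma br_of_path {V : Type} {G : SimpleGraph V} {u z : V} (q : G.Walk u z) :
    ∀ p, q.IsPath → p ∉ q.support → Br G p u z := by
  induction q with
  | nil => intro p _ _; exact .root _ _
  | cons h q ih =>
    intro p hq hp
    rw [Walk.cons_isPath_iff] at hq
    simp only [Walk.support_cons, List.mem_cons, not_or] at hp
    refine .step _ _ _ _ h ?_ (ih _ hq.1 hq.2)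
    rintro rfl
    exact hp.2 (Walk.start_mem_support q)

lemma br_total {V : Type} {G : SimpleGraph V} (hG : G.Connected) (c z : V) : Br G c c z := by
  obtain ⟨q, hq⟩ := hG.exists_isPath c z
  cases q with
  | nil => exact .root _ _
  | cons h q =>
    rw [Walk.cons_isPath_iff] at hq
    exact .step _ _ _ _ h h.ne' (br_of_path q _ hq.1 hq.2)

/-! ### Adding a leaf -/

/-- `G` arises from `H`, in which `v` is isolated, by joining `v` to `y`. -/
structure IsAdd {V : Type} (H G : SimpleGraph V) (y v : V) : Prop where
  ne : y ≠ v
  iso : ∀ w, ¬ H.Adj v w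
  adj : ∀ a b, G.Adj a b ↔ H.Adj a b ∨ (a = y ∧ b = v) ∨ (a = v ∧ b = y)

section add
set_option linter.unusedSectionVars false
variable {V : Type} [Fintype V] {H G : SimpleGraph V} {x y v : V}

lemma IsAdd.le (h : IsAdd H G y v) : H ≤ G := fun a b hab => (h.adj a b).2 (Or.inl hab)

lemma IsAdd.acyc (h : IsAdd H G y v) (hG : G.IsAcyclic) : H.IsAcyclic := hG.anti h.le

lemma IsAdd.iso' (h : IsAdd H G y v) (w : V) : ¬ H.Adj w v := fun h' => h.iso w h'.symm

lemma IsAdd.adj_of (h : IsAdd H G y v) {a b : V} (ha : a ≠ v) (hb : b ≠ v) (hab : G.Adj a b) :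
    H.Adj a b := by
  have := (h.adj a b).1 hab
  tauto

lemma IsAdd.adj_yv (h : IsAdd H G y v) : G.Adj y v := (h.adj y v).2 (by tauto)

lemma IsAdd.adj_v (h : IsAdd H G y v) {a : V} (ha : G.Adj a v) : a = y := by
  have := (h.adj a v).1 ha
  have h1 := h.iso' a
  have := h.ne
  tauto

lemma IsAdd.kids_ne (h : IsAdd H G y v) {p u : V} (hu : u ≠ v) (hy : u ≠ y) :
    kids G p u = kids H p u := by
  ext w
  rw [mem_kids, mem_kids, h.adj]
  tauto

lemma IsAdd.code_leaf (h : IsAdd H G y v) (hG : G.IsAcyclic) : code G y v = node 0 := by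
  have : kids G y v = ∅ := by
    ext w
    rw [mem_kids, h.adj]
    have := h.iso w
    have := h.ne
    simp; tauto
  rw [code_eq hG, this]; rfl

lemma IsAdd.kids_val (h : IsAdd H G y v) {p : V} (hp : p ≠ v) :
    (kids G p y).val = v ::ₘ (kids H p y).val := by
  classical
  have hv : v ∉ kids H p y := by rw [mem_kids]; exact fun h' => h.iso' _ h'.1
  have : kids G p y = insert v (kids H p y) := by
    ext w
    rw [Finset.mem_insert, mem_kids, mem_kids, h.adj]
    have := h.ne
    have := hp.symm
    constructor
    · tauto
    · rintro (rfl | h1)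
      · simp [hp.symm]
      · tauto
  rw [this, Finset.insert_val_of_notMem hv]

lemma IsAdd.code_same (h : IsAdd H G y v) (hG : G.IsAcyclic) (p u : V) :
    u ≠ v → ¬ Br H p u y → code G p u = code H p u := by
  refine kid_ind (h.acyc hG) (fun p u => u ≠ v → ¬ Br H p u y → code G p u = code H p u) ?_ p u
  intro p u ih hu hy
  have huy : u ≠ y := by rintro rfl; exact hy (.root _ _)
  rw [code_eq hG, code_eq (h.acyc hG), h.kids_ne hu huy, node_inj]
  refine Multiset.map_congr rfl (fun w hw => ?_)
  have hw' : w ∈ kids H p u := hw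
  have hw2 := mem_kids.1 hw'
  refine ih w hw' ?_ (fun hb => hy (.step _ _ _ _ hw2.1 hw2.2 hb))
  rintro rfl
  exact h.iso' _ hw2.1

/-- adding at the root of a branch -/
lemma IsAdd.code_root (h : IsAdd H G y v) (hG : G.IsAcyclic) {p : V} (hp : p ≠ v) :
    code G p y = node (node 0 ::ₘ (kids H p y).val.map (code H y)) := by
  rw [code_eq hG, h.kids_val hp, Multiset.map_cons, h.code_leaf hG, node_inj]
  congr 1
  refine Multiset.map_congr rfl (fun w hw => ?_)
  have hw' : w ∈ kids H p y := hw
  have hw2 := mem_kids.1 hw'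
  refine h.code_same hG _ _ ?_ (Br.not_self (h.acyc hG) hw2.1)
  rintro rfl
  exact h.iso' _ hw2.1

lemma map_erase [DecidableEq V] (f : V → ℕ) {s : Finset V} {w : V} (hw : w ∈ s) :
    s.val.map f = f w ::ₘ (s.erase w).val.map f := by
  have h1 : insert w (s.erase w) = s := Finset.insert_erase hw
  have h2 : s.val = w ::ₘ (s.erase w).val := by
    rw [← Finset.insert_val_of_notMem (Finset.notMem_erase w s), h1]
  rw [h2, Multiset.map_cons]

/-- adding deeper in a branch -/
lemma IsAdd.code_kid [DecidableEq V] (h : IsAdd H G y v) (hG : G.IsAcyclic) {p u w : V}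
    (hw : w ∈ kids H p u) (hb : Br H u w y) :
    code G p u = node (code G u w ::ₘ ((kids H p u).erase w).val.map (code H u)) := by
  have hw2 := mem_kids.1 hw
  have huy : u ≠ y := by rintro rfl; exact Br.not_self (h.acyc hG) hw2.1 hb
  have huv : u ≠ v := by rintro rfl; exact h.iso _ hw2.1
  rw [code_eq hG, h.kids_ne huv huy, node_inj, map_erase _ hw]
  congr 1
  refine Multiset.map_congr rfl (fun w' hw' => ?_)
  have hw3 : w' ∈ (kids H p u).erase w := hw'
  rw [Finset.mem_erase, mem_kids] at hw3
  refine h.code_same hG _ _ ?_ (fun hb' => hw3.1 (hb'.disj (h.acyc hG) hb hw3.2.1 hw2.1))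
  rintro rfl
  exact h.iso' _ hw3.2.1

lemma code_kid_self [DecidableEq V] (hH : H.IsAcyclic) {p u w : V} (hw : w ∈ kids H p u) :
    code H p u = node (code H u w ::ₘ ((kids H p u).erase w).val.map (code H u)) := by
  rw [code_eq hH, map_erase _ hw]

lemma IsAdd.del (h : IsAdd H G y v) (hG : G.IsAcyclic) {p u : V} (hp : p ≠ v)
    (hb : Br H p u y) : Del (code G p u) (code H p u) := by
  classical
  obtain ⟨z, hz⟩ : ∃ z, z = y := ⟨y, rfl⟩
  rw [← hz] at hb
  induction hb with
  | root p u =>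
    subst hz
    exact .leaf _ _ _ (h.code_root hG hp) (code_eq (h.acyc hG) _ _)
  | step p u w z h1 h2 h3 ih =>
    subst hz
    have hw := mem_kids.2 ⟨h1, h2⟩
    refine .step _ _ _ _ _ (h.code_kid hG hw h3) (code_kid_self (h.acyc hG) hw) (ih ?_ rfl)
    rintro rfl
    exact h.iso _ h1

lemma IsAdd.sz_add (h : IsAdd H G y v) (hG : G.IsAcyclic) {p u : V} (hp : p ≠ v) (hu : u ≠ v) :
    szc (code H p u) ≤ szc (code G p u) ∧ szc (code G p u) ≤ szc (code H p u) + 1 := by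
  by_cases hb : Br H p u y
  · have := (h.del hG hp hb).sz
    omega
  · rw [h.code_same hG p u hu hb]; omega

lemma IsAdd.br_total (h : IsAdd H G y v) (hG : G.IsTree) {c z : V} (hc : c ≠ v) (hz : z ≠ v) :
    Br H c c z := by
  have key : ∀ p u z, Br G p u z → u ≠ v → z ≠ v → Br H p u z := by
    intro p u z hb
    induction hb with
    | root => intros; exact .root _ _
    | step p u w z h1 h2 h3 ih =>
      intro hu hz
      by_cases hw : w = v
      · subst hw
        exfalso
        have hu' := h.adj_v h1
        subst hu'
        cases h3 with
        | root => exact hz rfl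
        | step _ _ w' _ h4 h5 h6 => exact h5 (h.adj_v h4.symm)
      · exact .step _ _ w _ (h.adj_of hu hw h1) h2 (ih hw hz)
  exact key _ _ _ (ErnPaper.br_total hG.connected c z) hc hz

/-- removing a leaf -/
lemma exists_isAdd (G : SimpleGraph V) {u w : V} (huw : G.Adj u w) (hk : kids G u w = ∅) :
    ∃ H, IsAdd H G u w := by
  refine ⟨⟨fun a b => G.Adj a b ∧ a ≠ w ∧ b ≠ w, ⟨fun a b h => ⟨h.1.symm, h.2.2, h.2.1⟩⟩,
    ⟨fun a h => G.loopless.irrefl a h.1⟩⟩, huw.ne, fun z hz => hz.2.1 rfl, fun a b => ?_⟩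
  have key : ∀ z, G.Adj w z → z = u := by
    intro z hz
    by_contra hc
    have : z ∈ kids G u w := mem_kids.2 ⟨hz, hc⟩
    simp [hk] at this
  constructor
  · intro hab
    by_cases ha : a = w
    · subst ha; exact Or.inr (Or.inr ⟨rfl, key _ hab⟩)
    · by_cases hb : b = w
      · subst hb; exact Or.inr (Or.inl ⟨key _ hab.symm, rfl⟩)
      · exact Or.inl ⟨hab, ha, hb⟩
  · rintro (h | ⟨rfl, rfl⟩ | ⟨rfl, rfl⟩)
    · exact h.1
    · exact huw
    · exact huw.symm

/-- every branch with at least two vertices has an irreplaceable leaf -/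
lemma exists_irr (hG : G.IsAcyclic) (p u : V) : (p = u ∨ G.Adj p u) → (kids G p u).Nonempty →
    ∃ x v H, IsAdd H G x v ∧ v ≠ p ∧ v ≠ u ∧ Br H p u x ∧
      ∀ y G', IsAdd H G' y v → G'.IsAcyclic → Br H p u y → y ≠ x →
        code G' p u ≠ code G p u := by
  classical
  refine kid_ind hG (fun p u => (p = u ∨ G.Adj p u) → (kids G p u).Nonempty →
    ∃ x v H, IsAdd H G x v ∧ v ≠ p ∧ v ≠ u ∧ Br H p u x ∧
      ∀ y G', IsAdd H G' y v → G'.IsAcyclic → Br H p u y → y ≠ x →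
        code G' p u ≠ code G p u) ?_ p u
  intro p u ih hpu hne
  obtain ⟨w, hw, hmin⟩ := Finset.exists_min_image (kids G p u) (fun w => szc (code G u w)) hne
  have hw2 := mem_kids.1 hw
  by_cases hk : kids G u w = ∅
  · obtain ⟨H, hH⟩ := exists_isAdd G hw2.1 hk
    refine ⟨u, w, H, hH, hw2.2, hw2.1.ne', .root _ _, ?_⟩
    intro y G' hA hG' hb hy hc
    cases hb with
    | root => exact hy rfl
    | step _ _ w' _ h1 h2 h3 =>
      have hw' : w' ∈ kids H p u := mem_kids.2 ⟨h1, h2⟩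
      rw [hA.code_kid hG' hw' h3, hH.code_root hG (Ne.symm hw2.2), node_inj] at hc
      have := congrArg Multiset.card hc
      have h5 := Finset.card_erase_add_one hw'
      simp only [Multiset.card_cons, Multiset.card_map, Finset.card_val] at this
      omega
  · obtain ⟨x, v, H, hH, hv1, hv2, hx, hirr⟩ := ih w hw (Or.inr hw2.1)
      (Finset.nonempty_iff_ne_empty.2 hk)
    have hH' := hH.acyc hG
    have huw : H.Adj u w := hH.adj_of hv1.symm hv2.symm hw2.1
    have hwH : w ∈ kids H p u := mem_kids.2 ⟨huw, hw2.2⟩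
    have hvp : v ≠ p := by
      rintro rfl
      rcases hpu with rfl | hpu
      · exact hv1 rfl
      · have := hH.adj_v hpu.symm
        subst this
        exact Br.not_self hH' huw hx
    refine ⟨x, v, H, hH, hvp, hv1, .step _ _ _ _ huw hw2.2 hx, ?_⟩
    intro y G' hA hG' hb hy hc
    have hGc := hH.code_kid hG hwH hx
    cases hb with
    | root =>
      rw [hA.code_root hG' hvp.symm, hGc, node_inj] at hc
      have := congrArg Multiset.card hc
      have h5 := Finset.card_erase_add_one hwH
      simp only [Multiset.card_cons, Multiset.card_map, Finset.card_val] at this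
      omega
    | step _ _ w' _ h1 h2 h3 =>
      have hw' : w' ∈ kids H p u := mem_kids.2 ⟨h1, h2⟩
      rw [hA.code_kid hG' hw' h3] at hc
      by_cases hww : w' = w
      · subst hww
        rw [hGc, node_inj, Multiset.cons_inj_left] at hc
        exact hirr y G' hA hG' h3 hy hc
      · rw [code_eq hG p u, node_inj] at hc
        have hm : code H u w ∈ (kids G p u).val.map (code G u) := by
          rw [← hc]
          refine Multiset.mem_cons_of_mem (Multiset.mem_map_of_mem _ ?_)
          exact Finset.mem_erase.2 ⟨Ne.symm hww, hwH⟩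
        obtain ⟨w2, hw2', he⟩ := Multiset.mem_map.1 hm
        have h6 := hmin w2 hw2'
        have h7 := (hH.del hG hv1.symm hx).sz
        simp only [he] at h6
        omega

end add

/-! ### Centroids -/

section cent
set_option linter.unusedSectionVars false
variable {V : Type} [Fintype V] {G : SimpleGraph V}

lemma code_edge (hG : G.IsAcyclic) {c b : V} (h : G.Adj c b) :
    code G c c = node (code G c b ::ₘ chc (code G b c)) := by
  classical
  have hb : b ∈ kids G c c := mem_kids.2 ⟨h, h.ne'⟩
  rw [code_kid_self hG hb, ch_code hG]
  have : (kids G c c).erase b = kids G b c := by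
    ext w
    simp only [Finset.mem_erase, mem_kids]
    constructor
    · rintro ⟨h1, h2, h3⟩; exact ⟨h2, h1⟩
    · rintro ⟨h1, h2⟩; exact ⟨h2, h1, h1.ne'⟩
  rw [this]

lemma sz_edge (hG : G.IsAcyclic) {c b : V} (h : G.Adj c b) :
    szc (code G c c) = szc (code G c b) + szc (code G b c) := by
  have h1 : szc (code G b c) = ((chc (code G b c)).map szc).sum + 1 := by
    rw [← sz_node, node_ch hG]
  rw [code_edge hG h, sz_node, h1, Multiset.map_cons, Multiset.sum_cons]
  omega

lemma sz_const (hG : G.IsTree) (c d : V) : szc (code G c c) = szc (code G d d) := by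
  obtain ⟨q⟩ := hG.connected c d
  induction q with
  | nil => rfl
  | cons h q ih =>
    rw [← ih, sz_edge hG.isAcyclic h, sz_edge hG.isAcyclic h.symm, add_comm]

def Cent (G : SimpleGraph V) (c : V) : Prop :=
  ∀ w, G.Adj c w → 2 * szc (code G c w) ≤ szc (code G c c)

lemma cent_of_edge (hG : G.IsAcyclic) {c b : V} (h : G.Adj c b)
    (h1 : 2 * szc (code G c b) ≤ szc (code G c c))
    (h2 : 2 * (szc (code G b c) - 1) ≤ szc (code G c c)) : Cent G c := by
  intro w hw
  by_cases hb : w = b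
  · subst hb; exact h1
  · have := sz_kid hG (mem_kids.2 ⟨hw, hb⟩ : w ∈ kids G b c)
    omega

lemma exists_cent (hG : G.IsTree) : ∃ c, Cent G c := by
  classical
  obtain ⟨c0⟩ := hG.connected.nonempty
  by_cases hex : ∃ e : V × V, G.Adj e.1 e.2 ∧ szc (code G c0 c0) < 2 * szc (code G e.1 e.2)
  · obtain ⟨e, he, hmin⟩ := Finset.exists_min_image
      (Finset.univ.filter (fun e : V × V => G.Adj e.1 e.2 ∧
        szc (code G c0 c0) < 2 * szc (code G e.1 e.2))) (fun e => szc (code G e.1 e.2))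
      (by obtain ⟨e, he⟩ := hex; exact ⟨e, by simpa using he⟩)
    obtain ⟨p, u⟩ := e
    simp only [Finset.mem_filter, Finset.mem_univ, true_and] at he hmin
    refine ⟨u, fun w hw => ?_⟩
    rw [sz_const hG u c0]
    by_contra hc
    push Not at hc
    by_cases hwp : w = p
    · subst hwp
      have := sz_edge hG.isAcyclic hw
      rw [sz_const hG u c0] at this
      omega
    · have h1 := hmin (u, w) ⟨hw, hc⟩
      have h2 := sz_kid hG.isAcyclic (mem_kids.2 ⟨hw, hwp⟩ : w ∈ kids G p u)
      simp only at h1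
      omega
  · push Not at hex
    exact ⟨c0, fun w hw => hex (c0, w) hw⟩

lemma br_big (hG : G.IsTree) {p u z : V} (h : Br G p u z) : G.Adj p u →
    ∃ w, G.Adj z w ∧ szc (code G u p) ≤ szc (code G z w) ∧
      (z ≠ u → szc (code G u p) < szc (code G z w)) := by
  induction h with
  | root p u => intro h; exact ⟨p, h.symm, le_rfl, fun h => absurd rfl h⟩
  | step p u w z h1 h2 h3 ih =>
    intro hpu
    obtain ⟨w', h4, h5, _⟩ := ih h1
    have h6 := sz_kid hG.isAcyclic (mem_kids.2 ⟨hpu.symm, Ne.symm h2⟩ : p ∈ kids G w u)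
    exact ⟨w', h4, by omega, fun _ => by omega⟩

lemma cent_two (hG : G.IsTree) {c d : V} (hc : Cent G c) (hd : Cent G d) (hne : c ≠ d) :
    G.Adj c d ∧ 2 * szc (code G c d) = szc (code G c c) := by
  have hb := br_total hG.connected c d
  cases hb with
  | root => exact absurd rfl hne
  | step _ _ w _ h1 h2 h3 =>
    obtain ⟨w', h4, h5, h6⟩ := br_big hG h3 h1
    have h7 := hd w' h4
    have h8 := hc w h1
    have h9 := sz_edge hG.isAcyclic h1
    rw [sz_const hG d c] at h7
    by_cases hw : d = w
    · subst hw
      exact ⟨h1, by omega⟩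
    · have := h6 hw
      omega

lemma cent_three (hG : G.IsTree) {a b d : V} (ha : Cent G a) (hb : Cent G b) (hd : Cent G d)
    (hab : a ≠ b) : d = a ∨ d = b := by
  by_contra! hc
  obtain ⟨h1, h2⟩ := cent_two hG ha hb hab
  obtain ⟨h3, h4⟩ := cent_two hG ha hd hc.1.symm
  have h5 := sz_edge hG.isAcyclic h1
  have h6 := sz_kid hG.isAcyclic (mem_kids.2 ⟨h3, hc.2⟩ : d ∈ kids G b a)
  omega

end cent

/-! ### Recognising paths and spiders -/

section recog
set_option linter.unusedSectionVars false
variable {V : Type} [Fintype V] {G : SimpleGraph V}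

lemma iso_of_hom {W : Type} {K : SimpleGraph W} (hG : G.IsAcyclic) (f : W → V)
    (hf : Function.Bijective f) (hom : ∀ a b, K.Adj a b → G.Adj (f a) (f b))
    (hK : K.Preconnected) : Nonempty (G ≃g K) := by
  classical
  refine ⟨(RelIso.symm ⟨Equiv.ofBijective f hf, ?_⟩ : G ≃g K)⟩
  intro a b
  refine ⟨fun h => ?_, fun h => hom _ _ h⟩
  have h : G.Adj (f a) (f b) := h
  obtain ⟨q, hq⟩ := (hK a b).exists_isPath
  let F : K →g G := ⟨f, fun {a b} h => hom a b h⟩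
  have h1 : (q.map F).IsPath := hq.map hf.1
  have h2 : (Walk.cons h Walk.nil : G.Walk (f a) (f b)).IsPath := by
    simp [Walk.cons_isPath_iff, h.ne]
  have h3 : q.map F = Walk.cons h Walk.nil :=
    congrArg Subtype.val ((hG.subsingleton_path (f a) (f b)).elim ⟨_, h1⟩ ⟨_, h2⟩)
  have h4 := congrArg Walk.length h3
  simp at h4
  exact Walk.adj_of_length_eq_one h4

lemma path_list (hG : G.IsAcyclic) {a : ℕ} (ha : IsPC a) : ∀ p u, G.Adj p u → code G p u = a →
    ∃ t : List V, List.IsChain G.Adj (u :: t) ∧ (u :: t).Nodup ∧ (u :: t).length = szc a ∧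
      ∀ z, Br G p u z ↔ z ∈ u :: t := by
  classical
  induction ha with
  | leaf a ha =>
    intro p u hpu hc
    rw [code_eq hG, ha, node_inj, Multiset.map_eq_zero, Finset.val_eq_zero] at hc
    refine ⟨[], by simp, by simp, by simp [ha, sz_node], fun z => ?_⟩
    constructor
    · intro h
      cases h with
      | root => simp
      | step _ _ w _ h1 h2 h3 =>
        have : w ∈ kids G p u := mem_kids.2 ⟨h1, h2⟩
        simp [hc] at this
    · intro h
      simp at h
      subst h
      exact .root _ _
  | up a b ha hb ih =>
    intro p u hpu hc
    rw [code_eq hG, ha, node_inj] at hc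
    have hcard := congrArg Multiset.card hc
    rw [Multiset.card_map, Finset.card_val, Multiset.card_singleton, Finset.card_eq_one] at hcard
    obtain ⟨w, hw⟩ := hcard
    rw [hw] at hc
    simp at hc
    have hw2 : G.Adj u w ∧ w ≠ p := mem_kids.1 (by rw [hw]; simp)
    obtain ⟨t, h1, h2, h3, h4⟩ := ih u w hw2.1 hc
    refine ⟨w :: t, ?_, ?_, ?_, ?_⟩
    · rw [List.isChain_cons_cons]; exact ⟨hw2.1, h1⟩
    · rw [List.nodup_cons]
      exact ⟨fun h => Br.not_self hG hw2.1 ((h4 u).2 h), h2⟩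
    · rw [ha, sz_node, List.length_cons, h3]; simp
    · intro z
      rw [List.mem_cons, ← h4]
      constructor
      · intro h
        cases h with
        | root => simp
        | step _ _ w' _ k1 k2 k3 =>
          have : w' ∈ kids G p u := mem_kids.2 ⟨k1, k2⟩
          rw [hw, Finset.mem_singleton] at this
          exact Or.inr (this ▸ k3)
      · rintro (rfl | h)
        · exact .root _ _
        · exact .step _ _ w _ hw2.1 hw2.2 h

lemma path_iso (hG : G.IsAcyclic) (L : List V) (hc : List.IsChain G.Adj L) (hn : L.Nodup)
    (hm : ∀ z, z ∈ L) : ∃ k, Nonempty (G ≃g pathGraph k) := by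
  refine ⟨L.length, iso_of_hom hG L.get ⟨List.nodup_iff_injective_get.1 hn, fun z => ?_⟩ ?_ ?_⟩
  · obtain ⟨i, hi⟩ := List.mem_iff_get.1 (hm z)
    exact ⟨i, hi⟩
  · have key : ∀ i j : Fin L.length, i.1 + 1 = j.1 → G.Adj (L.get i) (L.get j) := by
      intro i j hij
      have := List.isChain_iff_getElem.1 hc i.1 (by omega)
      simpa [hij] using this
    intro i j hij
    rw [pathGraph_adj] at hij
    rcases hij with h | h
    · exact key _ _ h
    · exact (key _ _ h).symm
  · exact pathGraph_preconnected _

lemma path_of_codes (hG : G.IsTree) {a b : V} (hab : G.Adj a b) (h1 : IsPC (code G a b))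
    (h2 : IsPC (code G b a)) : ∃ k, Nonempty (G ≃g pathGraph k) := by
  obtain ⟨t, t1, t2, t3, t4⟩ := path_list hG.isAcyclic h1 a b hab rfl
  obtain ⟨s, s1, s2, s3, s4⟩ := path_list hG.isAcyclic h2 b a hab.symm rfl
  refine path_iso hG.isAcyclic ((a :: s).reverse ++ (b :: t)) ?_ ?_ ?_
  · rw [List.isChain_append]
    refine ⟨?_, t1, ?_⟩
    · rw [List.isChain_reverse]
      exact s1.imp (fun _ _ h => h.symm)
    · intro x hx y hy
      simp at hx hy
      subst hx hy
      exact hab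
  · refine List.Nodup.append (List.nodup_reverse.2 s2) t2 ?_
    intro z hz hz'
    rw [List.mem_reverse, ← s4] at hz
    rw [← t4] at hz'
    exact hz'.disj2 hG.isAcyclic hab hz
  · intro z
    rw [List.mem_append, List.mem_reverse, ← s4, ← t4]
    exact (br_total hG.connected a z).split

lemma spider_conn (p q r : ℕ) : (spider p q r).Preconnected := by
  have h1 : ∀ n, ∀ h : n < p, (spider p q r).Reachable (Sum.inl ()) (Sum.inr (Sum.inl ⟨n, h⟩)) := by
    intro n
    induction n with
    | zero => intro h; exact Adj.reachable (by simp [spider])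
    | succ n ih => intro h; exact (ih (by omega)).trans (Adj.reachable (by simp [spider]))
  have h2 : ∀ n, ∀ h : n < q,
      (spider p q r).Reachable (Sum.inl ()) (Sum.inr (Sum.inr (Sum.inl ⟨n, h⟩))) := by
    intro n
    induction n with
    | zero => intro h; exact Adj.reachable (by simp [spider])
    | succ n ih => intro h; exact (ih (by omega)).trans (Adj.reachable (by simp [spider]))
  have h3 : ∀ n, ∀ h : n < r,
      (spider p q r).Reachable (Sum.inl ()) (Sum.inr (Sum.inr (Sum.inr ⟨n, h⟩))) := by
    intro n
    induction n with
    | zero => intro h; exact Adj.reachable (by simp [spider])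
    | succ n ih => intro h; exact (ih (by omega)).trans (Adj.reachable (by simp [spider]))
  have key : ∀ x, (spider p q r).Reachable (Sum.inl ()) x := by
    rintro (⟨⟩ | i | i | i)
    · exact Reachable.refl _
    · exact h1 _ i.2
    · exact h2 _ i.2
    · exact h3 _ i.2
  intro x y
  exact (key x).symm.trans (key y)

lemma spider_iso (hG : G.IsAcyclic) (c : V) (l1 l2 l3 : List V)
    (c1 : List.IsChain G.Adj (c :: l1)) (c2 : List.IsChain G.Adj (c :: l2))
    (c3 : List.IsChain G.Adj (c :: l3)) (hn : (c :: (l1 ++ (l2 ++ l3))).Nodup)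
    (hm : ∀ z, z ∈ c :: (l1 ++ (l2 ++ l3))) :
    Nonempty (G ≃g spider l1.length l2.length l3.length) := by
  simp only [List.nodup_cons, List.nodup_append, List.mem_append, not_or] at hn
  obtain ⟨⟨hc1, hc2, hc3⟩, n1, ⟨n2, n3, d23⟩, d1⟩ := hn
  have ch : ∀ l : List V, List.IsChain G.Adj (c :: l) → ∀ i j : Fin l.length, j.1 = i.1 + 1 →
      G.Adj (l.get i) (l.get j) := by
    intro l hl i j hij
    have := List.isChain_iff_getElem.1 hl (i.1 + 1) (by simp; omega)
    simpa [hij] using this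
  have ch0 : ∀ l : List V, List.IsChain G.Adj (c :: l) → ∀ j : Fin l.length, j.1 = 0 →
      G.Adj c (l.get j) := by
    intro l hl j hj
    have := List.isChain_iff_getElem.1 hl 0 (by have := j.2; simp; omega)
    simpa [hj] using this
  let f : Unit ⊕ (Fin l1.length ⊕ Fin l2.length ⊕ Fin l3.length) → V :=
    Sum.elim (fun _ => c) (Sum.elim l1.get (Sum.elim l2.get l3.get))
  refine iso_of_hom hG f ⟨?_, ?_⟩ ?_ (spider_conn _ _ _)
  · refine Function.Injective.sumElim (fun _ _ _ => rfl)
      (Function.Injective.sumElim (List.nodup_iff_injective_get.1 n1)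
        (Function.Injective.sumElim (List.nodup_iff_injective_get.1 n2)
          (List.nodup_iff_injective_get.1 n3) ?_) ?_) ?_
    · intro i j
      exact d23 _ (List.get_mem _ _) _ (List.get_mem _ _)
    · rintro i (j | j)
      · exact d1 _ (List.get_mem _ _) _ (Or.inl (List.get_mem _ _))
      · exact d1 _ (List.get_mem _ _) _ (Or.inr (List.get_mem _ _))
    · rintro _ (j | j | j) h
      · exact hc1 (by rw [h]; exact List.get_mem _ _)
      · exact hc2 (by rw [h]; exact List.get_mem _ _)
      · exact hc3 (by rw [h]; exact List.get_mem _ _)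
  · intro z
    have := hm z
    simp only [List.mem_cons, List.mem_append] at this
    rcases this with rfl | h | h | h
    · exact ⟨Sum.inl (), rfl⟩
    · obtain ⟨i, hi⟩ := List.mem_iff_get.1 h
      exact ⟨Sum.inr (Sum.inl i), hi⟩
    · obtain ⟨i, hi⟩ := List.mem_iff_get.1 h
      exact ⟨Sum.inr (Sum.inr (Sum.inl i)), hi⟩
    · obtain ⟨i, hi⟩ := List.mem_iff_get.1 h
      exact ⟨Sum.inr (Sum.inr (Sum.inr i)), hi⟩
  · rintro (a | a | a | a) (b | b | b | b) h <;>
      simp only [spider, fromRel_adj, or_false, false_or, and_false] at h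
    · exact ch0 _ c1 _ h.2
    · exact ch0 _ c2 _ h.2
    · exact ch0 _ c3 _ h.2
    · exact (ch0 _ c1 _ h.2).symm
    · rcases h.2 with h | h
      · exact ch _ c1 _ _ h
      · exact (ch _ c1 _ _ h).symm
    · exact (ch0 _ c2 _ h.2).symm
    · rcases h.2 with h | h
      · exact ch _ c2 _ _ h
      · exact (ch _ c2 _ _ h).symm
    · exact (ch0 _ c3 _ h.2).symm
    · rcases h.2 with h | h
      · exact ch _ c3 _ _ h
      · exact (ch _ c3 _ _ h).symm

end recog

/-! ### The main argument -/

section main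
set_option linter.unusedSectionVars false
variable {V : Type} [Fintype V] {T : SimpleGraph V}

/-- every end-edge is replaceable -/
def AllRep (T : SimpleGraph V) : Prop :=
  ∀ x v H, IsAdd H T x v → ∃ y G', IsAdd H G' y v ∧ y ≠ x ∧ Nonempty (G' ≃g T)

/-- strict centroid -/
def SCent (T : SimpleGraph V) (c : V) : Prop :=
  ∀ w, T.Adj c w → 2 * szc (code T c w) < szc (code T c c)

lemma isTree_of_iso {G' : SimpleGraph V} (hT : T.IsTree) (φ : G' ≃g T) : G'.IsTree :=
  φ.isTree_iff.2 hT

lemma sz_total {G' : SimpleGraph V} (hT : T.IsTree) (φ : G' ≃g T) (c d : V) :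
    szc (code G' c c) = szc (code T d d) := by
  rw [code_iso φ, sz_const hT]

lemma cent_code {G' : SimpleGraph V} (hT : T.IsTree) (φ : G' ≃g T) {c e : V} (hc : SCent T c)
    (he : Cent G' e) : code G' e e = code T c c := by
  have hG' := isTree_of_iso hT φ
  have hs : φ (φ.symm c) = c := φ.apply_symm_apply c
  have h1 : SCent G' (φ.symm c) := by
    intro w hw
    rw [code_iso φ, code_iso φ, hs]
    apply hc
    rw [← hs, φ.map_adj_iff]; exact hw
  have h2 : e = φ.symm c := by
    by_contra hne
    have hc' : Cent G' (φ.symm c) := fun w hw => (h1 w hw).le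
    obtain ⟨h3, h4⟩ := cent_two hG' hc' he (Ne.symm hne)
    have := h1 _ h3
    omega
  rw [h2, code_iso φ, hs]

/-- Irreplaceability within a branch -/
def Irr (T H : SimpleGraph V) (x v p u : V) : Prop :=
  ∀ y G', IsAdd H G' y v → G'.IsAcyclic → Br H p u y → y ≠ x → code G' p u ≠ code T p u

lemma shift_odd (hT : T.IsTree) (hR : AllRep T) {c b : V} (hc : SCent T c)
    (hN : szc (code T c c) = 2 * szc (code T c b) + 1) {x v : V} {H : SimpleGraph V}
    (hA : IsAdd H T x v) (hcb : H.Adj c b) (hx : Br H b c x) (hirr : Irr T H x v b c) :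
    ∃ B, Del B (code T c b) ∧
      code H b c ::ₘ chc B = code T c b ::ₘ chc (code T b c) := by
  have hTa := hT.isAcyclic
  have hHa := hA.acyc hTa
  obtain ⟨y, G', hA', hyx, ⟨φ⟩⟩ := hR x v H hA
  have hG' := isTree_of_iso hT φ
  have hGa := hG'.isAcyclic
  have hcv : c ≠ v := by rintro rfl; exact hA.iso _ hcb
  have hbv : b ≠ v := by rintro rfl; exact hA.iso' _ hcb
  have hTcb : T.Adj c b := hA.le hcb
  have hGcb : G'.Adj c b := hA'.le hcb
  have hxn : ¬ Br H c b x := hx.disj2 hHa hcb.symm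
  have hB : code T c b = code H c b := hA.code_same hTa _ _ hbv hxn
  have hN' : szc (code G' c c) = szc (code T c c) := sz_total hT φ c c
  have hN'' : szc (code G' b b) = szc (code T c c) := sz_total hT φ b c
  have hTs := sz_edge hTa hTcb
  have hGs := sz_edge hGa hGcb
  have hd := (hA.del hTa hbv hx).sz
  rcases (hA'.br_total hG' hcv hA'.ne : Br H c c y).split (b := b) with hy | hy
  · exfalso
    have hyn : ¬ Br H c b y := hy.disj2 hHa hcb.symm
    have hB' : code G' c b = code H c b := hA'.code_same hGa _ _ hbv hyn
    have hcent : Cent G' c := cent_of_edge hGa hGcb (by rw [hB', ← hB]; omega)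
      (by rw [hB', ← hB] at hGs; omega)
    have h1 := cent_code hT φ hc hcent
    rw [code_edge hGa hGcb, code_edge hTa hTcb, node_inj, hB', ← hB,
      Multiset.cons_inj_right] at h1
    apply hirr y G' hA' hGa hy hyx
    rw [← node_ch hGa, h1, node_ch hTa]
  · have hyn : ¬ Br H b c y := hy.disj2 hHa hcb
    have hC' : code G' b c = code H b c := hA'.code_same hGa _ _ hcv hyn
    have hD := hA'.del hGa hcv hy
    have hDs := hD.sz
    rw [← hB] at hDs
    have hcent : Cent G' b := cent_of_edge hGa hGcb.symm (by rw [hC']; omega) (by omega)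
    have h1 := cent_code hT φ hc hcent
    rw [code_edge hGa hGcb.symm, code_edge hTa hTcb, node_inj, hC'] at h1
    exact ⟨_, hB ▸ hD, h1⟩

lemma pair_aux (hG : T.IsAcyclic) {a b f : V} (hab : T.Adj a b) (hbf : T.Adj b f) (hfa : f ≠ a)
    (hs : szc (code T a b) = szc (code T b f) + 1) :
    code T a b = node {code T b f} ∧ code T f b = node {code T b a} := by
  classical
  have hk : f ∈ kids T a b := mem_kids.2 ⟨hbf, hfa⟩
  have h1 := code_kid_self hG hk
  have h2 : ((kids T a b).erase f).val.map (code T b) = 0 := by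
    rw [h1, sz_node, Multiset.map_cons, Multiset.sum_cons] at hs
    by_contra hne
    obtain ⟨e, he⟩ := Multiset.exists_mem_of_ne_zero hne
    have h3 : szc e ≤ ((((kids T a b).erase f).val.map (code T b)).map szc).sum :=
      Multiset.single_le_sum (by simp) _ (Multiset.mem_map_of_mem _ he)
    obtain ⟨w, _, rfl⟩ := Multiset.mem_map.1 he
    have := sz_pos hG b w
    omega
  rw [h2] at h1
  refine ⟨h1, ?_⟩
  have h3 := code_edge hG hbf
  rw [code_edge hG hab.symm, h1, ch_node, node_inj, Multiset.cons_swap,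
    Multiset.cons_inj_right] at h3
  rw [← node_ch hG f b, ← h3]
  rfl

lemma shift_even (hT : T.IsTree) (hR : AllRep T) {a b : V} (hab : T.Adj a b)
    (hs : szc (code T a b) = szc (code T b a)) {x v : V} {H : SimpleGraph V}
    (hA : IsAdd H T x v) (hHab : H.Adj a b) (hx : Br H b a x) (hirr : Irr T H x v b a) :
    ∃ E A', Del (node {E}) (code T a b) ∧ Del (code T b a) A' ∧
      ((E = code T b a ∧ node {A'} = code T a b) ∨
       (E = code T a b ∧ node {A'} = code T b a)) := by
  have hTa := hT.isAcyclic
  have hHa := hA.acyc hTa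
  obtain ⟨y, G', hA', hyx, ⟨φ⟩⟩ := hR x v H hA
  have hG' := isTree_of_iso hT φ
  have hGa := hG'.isAcyclic
  have hav : a ≠ v := by rintro rfl; exact hA.iso _ hHab
  have hbv : b ≠ v := by rintro rfl; exact hA.iso' _ hHab
  have hGab : G'.Adj a b := hA'.le hHab
  have hxn : ¬ Br H a b x := hx.disj2 hHa hHab.symm
  have hB : code T a b = code H a b := hA.code_same hTa _ _ hbv hxn
  have hTs := sz_edge hTa hab
  have hGs := sz_edge hGa hGab
  have hN' : szc (code G' a a) = szc (code T a a) := sz_total hT φ a a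
  have hN'' : szc (code G' b b) = szc (code T a a) := sz_total hT φ b a
  have hDT := hA.del hTa hbv hx
  have hDTs := hDT.sz
  -- the image of the bicentroid
  obtain ⟨d, hd⟩ : ∃ d, φ d = a := ⟨φ.symm a, φ.apply_symm_apply a⟩
  obtain ⟨e, he⟩ : ∃ e, φ e = b := ⟨φ.symm b, φ.apply_symm_apply b⟩
  have hde : G'.Adj d e := by rw [← φ.map_adj_iff, hd, he]; exact hab
  have cde : code G' d e = code T a b := by rw [code_iso φ, hd, he]
  have ced : code G' e d = code T b a := by rw [code_iso φ, hd, he]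
  have hNd : szc (code G' d d) = szc (code T a a) := sz_total hT φ d a
  have hNe : szc (code G' e e) = szc (code T a a) := sz_total hT φ e a
  have hcd : Cent G' d := cent_of_edge hGa hde (by rw [cde]; omega) (by rw [ced]; omega)
  have hce : Cent G' e := cent_of_edge hGa hde.symm (by rw [ced]; omega) (by rw [cde]; omega)
  rcases (hA'.br_total hG' hav hA'.ne : Br H a a y).split (b := b) with hy | hy
  · exfalso
    have hyn : ¬ Br H a b y := hy.disj2 hHa hHab.symm
    have hB' : code G' a b = code T a b := by rw [hB]; exact hA'.code_same hGa _ _ hbv hyn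
    have h1 := hirr y G' hA' hGa hy hyx
    rw [hB'] at hGs
    have hca : Cent G' a := cent_of_edge hGa hGab (by rw [hB']; omega) (by omega)
    have hcb : Cent G' b := cent_of_edge hGa hGab.symm (by omega) (by rw [hB']; omega)
    rcases cent_three hG' hca hcb hcd hGab.ne with rfl | rfl
    · rcases cent_three hG' hca hcb hce hGab.ne with rfl | rfl
      · exact hde.ne rfl
      · exact h1 ced
    · rcases cent_three hG' hca hcb hce hGab.ne with rfl | rfl
      · rw [hB'] at ced
        exact h1 (cde.trans ced)
      · exact hde.ne rfl
  · have hyn : ¬ Br H b a y := hy.disj2 hHa hHab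
    have hC' : code G' b a = code H b a := hA'.code_same hGa _ _ hav hyn
    have hD := hA'.del hGa hav hy
    rw [← hB] at hD
    have hDs := hD.sz
    have hcb : Cent G' b := cent_of_edge hGa hGab.symm (by rw [hC']; omega) (by omega)
    rcases cent_three hG' hcd hce hcb hde.ne with rfl | rfl
    · have hea : e ≠ a := by rintro rfl; rw [cde] at hC'; rw [← hC'] at hDTs; omega
      obtain ⟨h1, h2⟩ := pair_aux hGa hGab hde hea (by rw [cde]; omega)
      refine ⟨code G' b e, code H b a, h1 ▸ hD, hDT, Or.inr ⟨cde, ?_⟩⟩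
      rw [← hC', ← h2, ced]
    · have hea : d ≠ a := by rintro rfl; rw [ced] at hC'; rw [← hC'] at hDTs; omega
      obtain ⟨h1, h2⟩ := pair_aux hGa hGab hde.symm hea (by rw [ced]; omega)
      refine ⟨code G' b d, code H b a, h1 ▸ hD, hDT, Or.inl ⟨ced, ?_⟩⟩
      rw [← hC', ← h2, cde]

lemma kids_nonempty (hT : T.IsAcyclic) {p u : V} (h : 2 ≤ szc (code T p u)) :
    (kids T p u).Nonempty := by
  by_contra hc
  rw [Finset.not_nonempty_iff_eq_empty] at hc
  rw [code_eq hT, hc] at h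
  simp [sz_node] at h

lemma kids_empty (hT : T.IsAcyclic) {p u : V} (h : szc (code T p u) ≤ 1) :
    kids T p u = ∅ := by
  by_contra hc
  obtain ⟨w, hw⟩ := Finset.nonempty_iff_ne_empty.2 hc
  have := sz_kid hT hw
  have := sz_pos hT u w
  omega

lemma code_of_one (hT : T.IsAcyclic) {p u : V} (h : szc (code T p u) ≤ 1) :
    code T p u = node 0 := by
  rw [code_eq hT, kids_empty hT h]; rfl

lemma even_half (hT : T.IsTree) (hR : AllRep T) {a b : V} (hab : T.Adj a b)
    (hs : szc (code T a b) = szc (code T b a)) (h2 : 2 ≤ szc (code T b a)) :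
    (IsPC (code T a b) ∧ IsPC (code T b a)) ∨ Del (node {code T b a}) (code T a b) := by
  have hTa := hT.isAcyclic
  obtain ⟨x, v, H, hA, hvb, hva, hx, hirr⟩ := exists_irr hTa b a (Or.inr hab.symm)
    (kids_nonempty hTa h2)
  obtain ⟨E, A', h3, h4, ⟨rfl, h5⟩ | ⟨rfl, h5⟩⟩ := shift_even hT hR hab hs hA
    (hA.adj_of hva.symm hvb.symm hab) hx hirr
  · exact Or.inr h3
  · exact Or.inl ⟨path_self h3, (path_lemma h4 _ _ h4 h5 h5).1⟩

lemma case_even (hT : T.IsTree) (hR : AllRep T) {a b : V} (hab : T.Adj a b)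
    (hs : szc (code T a b) = szc (code T b a)) : ∃ k, Nonempty (T ≃g pathGraph k) := by
  have hTa := hT.isAcyclic
  by_cases h2 : 2 ≤ szc (code T b a)
  · rcases even_half hT hR hab hs h2 with h | h
    · exact path_of_codes hT hab h.1 h.2
    · rcases even_half hT hR hab.symm hs.symm (hs ▸ h2) with h' | h'
      · exact path_of_codes hT hab h'.2 h'.1
      · have := path_lemma h _ _ h' rfl rfl
        exact path_of_codes hT hab this.2.of_up this.1.of_up
  · exact path_of_codes hT hab (.leaf _ (code_of_one hTa (by omega)))
      (.leaf _ (code_of_one hTa (by omega)))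

lemma odd2_half (hT : T.IsTree) (hR : AllRep T) {a b c : V} (hc : SCent T c) (hcb : T.Adj c b)
    (hN : szc (code T c c) = 2 * szc (code T c b) + 1)
    (hC : code T b c = node {code T c a}) :
    (IsPC (code T c a) ∧ IsPC (code T c b)) ∨ Del (node {code T c a}) (code T c b) := by
  have hTa := hT.isAcyclic
  have h2 : 2 ≤ szc (code T b c) := by
    have := sz_pos hTa c a
    rw [hC, sz_node]; simp; omega
  obtain ⟨x, v, H, hA, hvb, hvc, hx, hirr⟩ := exists_irr hTa b c (Or.inr hcb.symm)
    (kids_nonempty hTa h2)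
  have hD := hA.del hTa hvb.symm hx
  obtain ⟨B, h3, h4⟩ := shift_odd hT hR hc hN hA
    (hA.adj_of hvc.symm hvb.symm hcb) hx hirr
  rw [hC, ch_node] at h4
  rw [hC] at hD
  have hB : B = node (chc B) := by
    cases h3 with
    | leaf _ _ M h => rw [h, ch_node]
    | step _ _ _ _ M h => rw [h, ch_node]
  have hcard := congrArg Multiset.card h4
  simp at hcard
  obtain ⟨E, hE⟩ := Multiset.card_eq_one.1 hcard
  rw [hE] at h4 hB
  rw [hB] at h3
  rw [Multiset.cons_eq_cons] at h4
  rcases h4 with ⟨h5, h6⟩ | ⟨_, M, h5, h6⟩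
  · rw [h5] at hD; exact Or.inr hD
  · rw [Multiset.singleton_eq_cons_iff] at h5 h6
    rw [← h6.1] at hD
    rw [h5.1] at h3
    exact Or.inl ⟨path_self hD, path_self h3⟩

end main

section fin
set_option linter.unusedSectionVars false
variable {V : Type} [Fintype V] {T : SimpleGraph V}

lemma case_odd2 (hT : T.IsTree) (hR : AllRep T) {a b c : V} (hc : SCent T c) (hcb : T.Adj c b)
    (hca : T.Adj c a) (hab : a ≠ b) (hN : szc (code T c c) = 2 * szc (code T c b) + 1)
    (hs : szc (code T c a) = szc (code T c b)) : ∃ k, Nonempty (T ≃g pathGraph k) := by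
  have hTa := hT.isAcyclic
  have h1 := sz_edge hTa hcb
  obtain ⟨e1, e2⟩ := pair_aux hTa hcb.symm hca hab (by omega)
  have key : IsPC (code T c a) → IsPC (code T c b) → ∃ k, Nonempty (T ≃g pathGraph k) :=
    fun h h' => path_of_codes hT hcb h' (.up _ _ e1 h)
  rcases odd2_half hT hR hc hcb hN e1 with h | h
  · exact key h.1 h.2
  · rcases odd2_half hT hR hc hca (hs ▸ hN) e2 with h' | h'
    · exact key h'.2 h'.1
    · have := path_lemma h _ _ h' rfl rfl
      exact key this.1.of_up this.2.of_up

lemma one_kid (hT : T.IsAcyclic) (c : V) (s : Finset V)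
    (h : ((s.val.map (code T c)).map szc).sum = 1) : ∃ l, s = {l} ∧ code T c l = node 0 := by
  classical
  have hne : s.Nonempty := by
    by_contra hc
    rw [Finset.not_nonempty_iff_eq_empty] at hc
    simp [hc] at h
  obtain ⟨l, hl⟩ := hne
  rw [map_erase _ hl, Multiset.map_cons, Multiset.sum_cons] at h
  have h1 := sz_pos hT c l
  refine ⟨l, ?_, code_of_one hT (by omega)⟩
  have h2 : s.erase l = ∅ := by
    by_contra hc
    obtain ⟨w, hw⟩ := Finset.nonempty_iff_ne_empty.2 hc
    rw [map_erase _ hw, Multiset.map_cons, Multiset.sum_cons] at h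
    have := sz_pos hT c w
    omega
  rw [← Finset.insert_erase hl, h2]; rfl

lemma erase_kids [DecidableEq V] (H : SimpleGraph V) (b c : V) :
    (kids H c c).erase b = kids H b c := by
  ext w
  simp only [Finset.mem_erase, mem_kids]
  constructor
  · rintro ⟨h1, h2, h3⟩; exact ⟨h2, h1⟩
  · rintro ⟨h1, h2⟩; exact ⟨h2, h1, h1.ne'⟩

lemma odd3_step1 (hT : T.IsTree) (hR : AllRep T) {b c : V} (hc : SCent T c) (hcb : T.Adj c b)
    (hN : szc (code T c c) = 2 * szc (code T c b) + 1)
    (hs : ∀ a ∈ kids T b c, szc (code T c a) < szc (code T c b)) :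
    ∃ w l, w ≠ l ∧ (∀ z, z ∈ kids T b c ↔ z = w ∨ z = l) ∧
      code T b c = node {code T c w, node 0} ∧
      code T c l = node 0 ∧ Del (code T c b) (code T c w) := by
  classical
  have hTa := hT.isAcyclic
  have hTs := sz_edge hTa hcb
  have hp := sz_pos hTa c b
  obtain ⟨a, ha⟩ := kids_nonempty hTa (show 2 ≤ szc (code T b c) by omega)
  have ha1 := hs a ha
  have ha2 := sz_pos hTa c a
  obtain ⟨x, v, H, hA, hvc, hvb, hx, hirr⟩ := exists_irr hTa c b (Or.inr hcb)
    (kids_nonempty hTa (by omega))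
  have hHa := hA.acyc hTa
  have hHcb : H.Adj c b := hA.adj_of hvc.symm hvb.symm hcb
  have hD := hA.del hTa hvc.symm hx
  have hDs := hD.sz
  have hcx : c ≠ x := by rintro rfl; exact Br.not_self hHa hHcb hx
  have hkids : kids T b c = kids H b c := hA.kids_ne hvc.symm hcx
  have hkid' : ∀ w, w ∈ kids H b c → code T c w = code H c w := by
    intro w hw
    have hw2 := mem_kids.1 hw
    refine hA.code_same hTa _ _ ?_ (fun h => hw2.2 (h.disj hHa hx hw2.1 hHcb))
    rintro rfl
    exact hA.iso' _ hw2.1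
  obtain ⟨y, G', hA', hyx, ⟨φ⟩⟩ := hR x v H hA
  have hG' := isTree_of_iso hT φ
  have hGa := hG'.isAcyclic
  have hN' : szc (code G' c c) = szc (code T c c) := sz_total hT φ c c
  have hcent : Cent G' c := by
    intro w hw
    by_cases hwv : w = v
    · subst hwv
      have := hA'.adj_v hw
      subst this
      rw [hA'.code_leaf hGa, sz_node]
      simp; omega
    · have hHw := hA'.adj_of hvc.symm hwv hw
      have h1 := (hA'.sz_add hGa hvc.symm hwv).2
      by_cases hwb : w = b
      · subst hwb; omega
      · have hk : w ∈ kids H b c := mem_kids.2 ⟨hHw, hwb⟩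
        have h2 := hs w (hkids ▸ hk)
        rw [hkid' w hk] at h2
        omega
  have hcode := cent_code hT φ hc hcent
  have hbk : b ∈ kids H c c := mem_kids.2 ⟨hHcb, hHcb.ne'⟩
  rw [hA.code_kid hTa hbk hx] at hcode
  have hbr := hA'.br_total hG' hvc.symm hA'.ne
  cases hbr with
  | root =>
    exfalso
    rw [hA'.code_root hGa hvc.symm, node_inj] at hcode
    have := congrArg Multiset.card hcode
    have h5 := Finset.card_erase_add_one hbk
    simp only [Multiset.card_cons, Multiset.card_map, Finset.card_val] at this
    omega
  | step _ _ w _ k1 k2 k3 =>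
    have hwk : w ∈ kids H c c := mem_kids.2 ⟨k1, k2⟩
    rw [hA'.code_kid hGa hwk k3, node_inj] at hcode
    by_cases hwb : w = b
    · subst hwb
      rw [Multiset.cons_inj_left] at hcode
      exact absurd hcode (hirr y G' hA' hGa k3 hyx)
    · have hw1 : w ∈ kids H b c := mem_kids.2 ⟨k1, hwb⟩
      have hbw : b ∈ (kids H c c).erase w := Finset.mem_erase.2 ⟨Ne.symm hwb, hbk⟩
      rw [map_erase _ hbw, Finset.erase_right_comm, erase_kids, map_erase _ hw1] at hcode
      have hwD : code H c b = code H c w := by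
        rw [Multiset.cons_eq_cons] at hcode
        rcases hcode with ⟨_, h⟩ | ⟨_, cs, h1, _⟩
        · rwa [Multiset.cons_inj_left] at h
        · exfalso
          have hm : code T c b ∈ code H c b ::ₘ ((kids H b c).erase w).val.map (code H c) := by
            rw [h1]; exact Multiset.mem_cons_self _ _
          rw [Multiset.mem_cons] at hm
          rcases hm with hm | hm
          · rw [hm] at hDs; omega
          · obtain ⟨w', hw', he⟩ := Multiset.mem_map.1 hm
            have hw3 : w' ∈ kids H b c := Finset.mem_of_mem_erase hw'
            have h2 := hs w' (hkids ▸ hw3)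
            rw [hkid' w' hw3, he] at h2
            omega
      have hDel : Del (code T c b) (code T c w) := by rw [hkid' w hw1, ← hwD]; exact hD
      have hDs' := hDel.sz
      rw [← hkids] at hw1
      have hsum := code_kid_self hTa hw1
      obtain ⟨l, hl, hl0⟩ := one_kid hTa c ((kids T b c).erase w) (by
        have h := congrArg szc hsum
        rw [sz_node, Multiset.map_cons, Multiset.sum_cons] at h
        omega)
      have hlm : l ∈ (kids T b c).erase w := by rw [hl]; simp
      refine ⟨w, l, Ne.symm (Finset.ne_of_mem_erase hlm), ?_, ?_, hl0, hDel⟩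
      · intro z
        rw [← Finset.insert_erase hw1, hl]
        simp
      · rw [hsum, hl]
        simp [hl0]

lemma node_card {M N : Multiset ℕ} (h : node M = node N) : Multiset.card M = Multiset.card N := by
  rw [node_inj.1 h]

lemma odd3_step2 (hT : T.IsTree) (hR : AllRep T) {b c w l : V} (hc : SCent T c) (hcb : T.Adj c b)
    (hN : szc (code T c c) = 2 * szc (code T c b) + 1)
    (hk : ∀ z, z ∈ kids T b c ↔ z = w ∨ z = l)
    (hC : code T b c = node {code T c w, node 0}) (hl0 : code T c l = node 0)
    (hD : Del (code T c b) (code T c w)) : code T c b = node {code T c w} := by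
  classical
  have hTa := hT.isAcyclic
  have hl := mem_kids.1 ((hk l).2 (Or.inr rfl))
  obtain ⟨H, hA⟩ := exists_isAdd T hl.1 (kids_empty hTa (by rw [hl0, sz_node]; simp))
  have hroot := hA.code_root hTa (Ne.symm hl.2)
  obtain ⟨B, _, h2⟩ := shift_odd hT hR hc hN hA (hA.adj_of hl.1.ne (Ne.symm hl.2) hcb)
    (.root _ _) (by
      intro y G' hA' hG' hb hy he
      cases hb with
      | root => exact hy rfl
      | step _ _ w' _ h1 h2 h3 =>
        have hw' : w' ∈ kids H b c := mem_kids.2 ⟨h1, h2⟩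
        rw [hA'.code_kid hG' hw' h3, hroot] at he
        have := node_card he
        have h5 := Finset.card_erase_add_one hw'
        simp only [Multiset.card_cons, Multiset.card_map, Finset.card_val] at this
        omega)
  have hH : code H b c = node {code T c w} := by
    rw [code_eq (hA.acyc hTa), node_inj]
    rw [hC, node_inj] at hroot
    have : ({code T c w, node 0} : Multiset ℕ) = node 0 ::ₘ {code T c w} :=
      Multiset.pair_comm _ _
    rw [this, Multiset.cons_inj_right] at hroot
    exact hroot.symm
  have hm : code H b c ∈ code T c b ::ₘ chc (code T b c) := by
    rw [← h2]; exact Multiset.mem_cons_self _ _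
  rw [hH, hC, ch_node] at hm
  simp only [Multiset.mem_cons, Multiset.insert_eq_cons, Multiset.mem_singleton] at hm
  rcases hm with hm | hm | hm
  · exact hm.symm
  · have := congrArg szc hm
    rw [sz_node] at this
    simp at this
  · have := node_card hm
    simp at this

lemma odd3_step3 (hT : T.IsTree) (hR : AllRep T) {b c w l : V} (hc : SCent T c) (hcb : T.Adj c b)
    (hN : szc (code T c c) = 2 * szc (code T c b) + 1)
    (hk : ∀ z, z ∈ kids T b c ↔ z = w ∨ z = l) (hwl : w ≠ l)
    (hC : code T b c = node {code T c w, node 0}) (hl0 : code T c l = node 0)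
    (hB : code T c b = node {code T c w}) : szc (code T c w) ≤ 2 := by
  classical
  have hTa := hT.isAcyclic
  by_contra! h3
  have hw := mem_kids.1 ((hk w).2 (Or.inl rfl))
  obtain ⟨x, v, H, hA, hvc, hvw, hx, hirr⟩ := exists_irr hTa c w (Or.inr hw.1)
    (kids_nonempty hTa (by omega))
  have hHa := hA.acyc hTa
  have hHcw : H.Adj c w := hA.adj_of hvc.symm hvw.symm hw.1
  have hcx : c ≠ x := by rintro rfl; exact Br.not_self hHa hHcw hx
  have hvb : b ≠ v := by
    rintro rfl
    exact hcx (hA.adj_v hcb)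
  have hkids : kids T b c = kids H b c := hA.kids_ne hvc.symm hcx
  have hwk : w ∈ kids H b c := mem_kids.2 ⟨hHcw, hw.2⟩
  have hbx : Br H b c x := .step _ _ w _ hHcw hw.2 hx
  have hTc := hA.code_kid hTa hwk hx
  have hcardT := Finset.card_erase_add_one hwk
  have hDel := (hA.del hTa hvb hbx).sz
  obtain ⟨B, _, h2⟩ := shift_odd hT hR hc hN hA (hA.adj_of hvc.symm hvb hcb) hbx (by
    intro y G' hA' hG' hb hy he
    cases hb with
    | root =>
      rw [hA'.code_root hG' hvb, hTc] at he
      have := node_card he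
      simp only [Multiset.card_cons, Multiset.card_map, Finset.card_val] at this
      omega
    | step _ _ w' _ h1 h2 h4 =>
      have hw' : w' ∈ kids H b c := mem_kids.2 ⟨h1, h2⟩
      by_cases hww : w' = w
      · subst hww
        rw [hA'.code_kid hG' hw' h4, hTc, node_inj, Multiset.cons_inj_left] at he
        exact hirr y G' hA' hG' h4 hy he
      · have hwl' : w' = l := by
          have := (hk w').1 (hkids ▸ hw')
          tauto
        subst hwl'
        have hvl : w' ≠ v := by rintro rfl; exact hA.iso' _ h1
        have hs1 := (hA'.del hG' hvc.symm h4).sz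
        rw [← hA.code_same hTa c w' hvl (fun h => hww (h.disj hHa hx h1 hHcw)), hl0, sz_node]
          at hs1
        have hm : code G' c w' ∈ chc (code T b c) := by
          rw [← he, hA'.code_kid hG' hw' h4, ch_node]; exact Multiset.mem_cons_self _ _
        rw [hC, ch_node] at hm
        simp only [Multiset.mem_cons, Multiset.insert_eq_cons, Multiset.mem_singleton] at hm
        rcases hm with hm | hm
        · rw [hm] at hs1; simp at hs1; omega
        · rw [hm, sz_node] at hs1; simp at hs1)
  have hm : code H b c ∈ code T c b ::ₘ chc (code T b c) := by
    rw [← h2]; exact Multiset.mem_cons_self _ _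
  rw [hC, sz_node] at hDel
  rw [hC, ch_node] at hm
  simp only [Multiset.mem_cons, Multiset.insert_eq_cons, Multiset.mem_singleton,
    Multiset.map_cons, Multiset.map_singleton, Multiset.sum_cons, Multiset.sum_singleton,
    sz_node, Multiset.map_zero, Multiset.sum_zero] at hm hDel
  rcases hm with hm | hm | hm
  · have h5 : code H b c = node {code T c w} := by rw [hm, hB]
    rw [code_eq hHa] at h5
    have h6 := node_card h5
    have h7 := hC
    rw [code_eq hTa, hkids] at h7
    have h8 := node_card h7
    simp at h6 h8
    omega
  · rw [hm] at hDel; omega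
  · rw [hm, sz_node] at hDel; simp at hDel; omega

lemma case_odd3 (hT : T.IsTree) (hR : AllRep T) {b c : V} (hc : SCent T c) (hcb : T.Adj c b)
    (hN : szc (code T c c) = 2 * szc (code T c b) + 1)
    (hs : ∀ a ∈ kids T b c, szc (code T c a) < szc (code T c b)) :
    Nonempty (T ≃g spider 1 1 2) ∨ Nonempty (T ≃g spider 1 2 3) := by
  have hTa := hT.isAcyclic
  obtain ⟨w, l, hwl, hk, hC, hl0, hD⟩ := odd3_step1 hT hR hc hcb hN hs
  have hB := odd3_step2 hT hR hc hcb hN hk hC hl0 hD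
  have h2 := odd3_step3 hT hR hc hcb hN hk hwl hC hl0 hB
  have hw := mem_kids.1 ((hk w).2 (Or.inl rfl))
  have hl := mem_kids.1 ((hk l).2 (Or.inr rfl))
  have hDp : IsPC (code T c w) := path_self (hB ▸ hD)
  have hBp : IsPC (code T c b) := .up _ _ hB hDp
  obtain ⟨t1, c1, n1, s1, m1⟩ := path_list hTa (.leaf _ hl0) c l hl.1 rfl
  obtain ⟨t2, c2, n2, s2, m2⟩ := path_list hTa hDp c w hw.1 rfl
  obtain ⟨t3, c3, n3, s3, m3⟩ := path_list hTa hBp c b hcb rfl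
  have key := spider_iso hTa c (l :: t1) (w :: t2) (b :: t3)
    (List.isChain_cons_cons.2 ⟨hl.1, c1⟩) (List.isChain_cons_cons.2 ⟨hw.1, c2⟩)
    (List.isChain_cons_cons.2 ⟨hcb, c3⟩)
    (by
      rw [List.nodup_cons, List.mem_append, List.mem_append, ← m1, ← m2, ← m3]
      refine ⟨?_, List.Nodup.append n1 (List.Nodup.append n2 n3 ?_) ?_⟩
      · rintro (h | h | h)
        · exact Br.not_self hTa hl.1 h
        · exact Br.not_self hTa hw.1 h
        · exact Br.not_self hTa hcb h
      · intro z hz hz'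
        rw [← m2] at hz
        rw [← m3] at hz'
        exact hw.2 (hz.disj hTa hz' hw.1 hcb)
      · intro z hz hz'
        rw [List.mem_append, ← m2, ← m3] at hz'
        rw [← m1] at hz
        rcases hz' with hz' | hz'
        · exact hwl (hz'.disj hTa hz hw.1 hl.1)
        · exact hl.2 (hz.disj hTa hz' hl.1 hcb))
    (by
      intro z
      rw [List.mem_cons, List.mem_append, List.mem_append, ← m1, ← m2, ← m3]
      have hz := br_total hT.connected c z
      cases hz with
      | root => exact Or.inl rfl
      | step _ _ w' _ k1 k2 k3 =>
        by_cases hb : w' = b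
        · subst hb; tauto
        · rcases (hk w').1 (mem_kids.2 ⟨k1, hb⟩) with rfl | rfl <;> tauto)
  rw [s1, s2, s3, hD.sz, hl0, sz_node] at key
  have := hDp.sz_pos
  rcases (by omega : szc (code T c w) = 1 ∨ szc (code T c w) = 2) with h | h
  · rw [h] at key; exact Or.inl key
  · rw [h] at key; exact Or.inr key

lemma main_lemma (hT : T.IsTree) (hE : T.edgeSet.Nonempty) (hR : AllRep T) :
    IsPseudopath T := by
  have hTa := hT.isAcyclic
  obtain ⟨c, hc⟩ := exists_cent hT
  have hck : (kids T c c).Nonempty := by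
    apply kids_nonempty hTa
    obtain ⟨e, he⟩ := hE
    induction e using Sym2.ind with
    | _ a b =>
      rw [mem_edgeSet] at he
      have h1 := sz_edge hTa he
      have := sz_pos hTa a b
      have := sz_pos hTa b a
      rw [sz_const hT c a]
      omega
  by_cases h1 : ∃ b, T.Adj c b ∧ 2 * szc (code T c b) = szc (code T c c)
  · obtain ⟨b, hb, hs⟩ := h1
    have := sz_edge hTa hb
    exact Or.inl (case_even hT hR hb (by omega))
  · have hsc : SCent T c := by
      intro w hw
      have := hc w hw
      by_contra hcon
      exact h1 ⟨w, hw, by omega⟩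
    by_cases h2 : ∃ b, T.Adj c b ∧ szc (code T c c) = 2 * szc (code T c b) + 1
    · obtain ⟨b, hb, hN⟩ := h2
      by_cases h3 : ∃ a ∈ kids T b c, szc (code T c a) = szc (code T c b)
      · obtain ⟨a, ha, hs⟩ := h3
        have ha' := mem_kids.1 ha
        exact Or.inl (case_odd2 hT hR hsc hb ha'.1 ha'.2 hN hs)
      · refine Or.inr (case_odd3 hT hR hsc hb hN (fun a ha => ?_))
        have h4 := hsc a (mem_kids.1 ha).1
        have h5 : szc (code T c a) ≠ szc (code T c b) := fun h => h3 ⟨a, ha, h⟩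
        omega
    · exfalso
      obtain ⟨x, v, H, hA, hvc, _, hx, hirr⟩ := exists_irr hTa c c (Or.inl rfl) hck
      obtain ⟨y, G', hA', hyx, ⟨φ⟩⟩ := hR x v H hA
      have hG' := isTree_of_iso hT φ
      refine hirr y G' hA' hG'.isAcyclic (hA'.br_total hG' hvc.symm hA'.ne) hyx
        (cent_code hT φ hsc ?_)
      intro w hw
      rw [sz_total hT φ c c]
      by_cases hwv : w = v
      · subst hwv
        have := hA'.adj_v hw
        subst this
        rw [hA'.code_leaf hG'.isAcyclic, sz_node]
        obtain ⟨z, hz⟩ := hck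
        have := hsc z (mem_kids.1 hz).1
        have := sz_pos hTa c z
        simp; omega
      · have hHw := hA'.adj_of hvc.symm hwv hw
        have h3 := (hA'.sz_add hG'.isAcyclic hvc.symm hwv).2
        have h4 := (hA.sz_add hTa hvc.symm hwv).1
        have h5 := hsc w (hA.le hHw)
        have h6 : szc (code T c c) ≠ 2 * szc (code T c w) + 1 := fun h => h2 ⟨w, hA.le hHw, h⟩
        have h7 : szc (code G' c w) ≤ szc (code T c w) + 1 := by omega
        omega

end fin

/-- Every finite tree with at least one edge which is not a pseudopath has an
irreplaceable end-edge. -/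
theorem stmt4 {V : Type} [Fintype V] (T : SimpleGraph V) (hT : T.IsTree)
    (hE : T.edgeSet.Nonempty) (hP : ¬ IsPseudopath T) :
    ∃ x v : V, T.Adj x v ∧ (T.neighborSet v).ncard = 1 ∧
      ∀ y : V, y ≠ x → y ≠ v → ¬ Nonempty (replaceEdge T x v y ≃g T) := by
  by_contra hcon
  refine hP (main_lemma hT hE ?_)
  intro x v H hA
  have hn : T.neighborSet v = {x} := by
    ext w
    rw [mem_neighborSet, Set.mem_singleton_iff]
    constructor
    · intro h; exact hA.adj_v h.symm
    · rintro rfl; exact hA.adj_yv.symm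
  by_contra hc
  refine hcon ⟨x, v, hA.adj_yv, by rw [hn, Set.ncard_singleton], fun y hyx hyv hφ => hc ?_⟩
  refine ⟨y, replaceEdge T x v y, ⟨hyv, hA.iso, fun a b => ?_⟩, hyx, hφ⟩
  have h1 := hA.adj a b
  have h2 := hA.iso a
  have h3 := hA.iso b
  have h4 := hA.iso' a
  have h5 := hA.iso' b
  have h6 := hA.ne
  have h7 : H.Adj a b → a ≠ v ∧ b ≠ v := by
    intro h
    constructor
    · rintro rfl; exact hA.iso _ h
    · rintro rfl; exact hA.iso' _ h
  have h8 : H.Adj a b → a ≠ b := fun h => h.ne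
  simp only [replaceEdge, fromEdgeSet_adj, Set.mem_union, Set.mem_diff, mem_edgeSet,
    Set.mem_singleton_iff, Sym2.eq_iff, h1]
  constructor
  · tauto
  · rintro (h | ⟨rfl, rfl⟩ | ⟨rfl, rfl⟩)
    · have := h7 h
      have := h8 h
      tauto
    · exact ⟨Or.inr (Or.inl ⟨rfl, rfl⟩), hyv⟩
    · exact ⟨Or.inr (Or.inr ⟨rfl, rfl⟩), hyv.symm⟩

end ErnPaper
end

section
/- For every odd integer n ≥ 5, the path P_n on n vertices has edge-reconstruction number ern(P_n) = 3. -/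
open SimpleGraph

namespace ErnPaper

/-- A self-map of `Fin n` that is injective and respects adjacency is an isomorphism. -/
lemma iso_of_inj {n : ℕ} {G H : SimpleGraph (Fin n)} (f : Fin n → Fin n)
    (hf : Function.Injective f) (h : ∀ u v, H.Adj (f u) (f v) ↔ G.Adj u v) :
    Nonempty (G ≃g H) :=
  ⟨{ toEquiv := Equiv.ofBijective f (Finite.injective_iff_bijective.mp hf)
     map_rel_iff' := by intro a b; exact h a b }⟩

/-- The `k`-th edge of the path. -/
def pe (n k : ℕ) (h : k + 1 < n) : Sym2 (Fin n) :=
  s((⟨k, by omega⟩ : Fin n), (⟨k + 1, h⟩ : Fin n))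

lemma pe_mem (n k : ℕ) (h : k + 1 < n) : pe n k h ∈ (pathGraph n).edgeSet := by
  simp [pe, pathGraph_adj]

lemma pe_inj {n i j : ℕ} (hi : i + 1 < n) (hj : j + 1 < n) (h : pe n i hi = pe n j hj) :
    i = j := by
  simp only [pe, Sym2.eq_iff, Fin.mk.injEq] at h
  omega

lemma exists_pe {n : ℕ} {e : Sym2 (Fin n)} (he : e ∈ (pathGraph n).edgeSet) :
    ∃ k h, e = pe n k h := by
  induction e with
  | _ u v =>
    rw [mem_edgeSet, pathGraph_adj] at he
    rcases he with h | h
    · exact ⟨u.val, by omega, Sym2.eq_iff.mpr (Or.inl ⟨rfl, Fin.ext h.symm⟩)⟩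
    · exact ⟨v.val, by omega, Sym2.eq_iff.mpr (Or.inr ⟨Fin.ext h.symm, rfl⟩)⟩

/-- The path with the `k`-th edge deleted. -/
def dp (n k : ℕ) : SimpleGraph (Fin n) where
  Adj u v := (u.val + 1 = v.val ∧ u.val ≠ k) ∨ (v.val + 1 = u.val ∧ v.val ≠ k)
  symm := ⟨by intro u v h; exact h.symm⟩
  loopless := ⟨by intro u h; omega⟩

lemma dp_adj {n k : ℕ} {u v : Fin n} : (dp n k).Adj u v ↔
    (u.val + 1 = v.val ∧ u.val ≠ k) ∨ (v.val + 1 = u.val ∧ v.val ≠ k) := Iff.rfl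

lemma del_pe (n k : ℕ) (h : k + 1 < n) :
    (pathGraph n).deleteEdges {pe n k h} = dp n k := by
  ext u v
  simp only [deleteEdges_adj, pathGraph_adj, pe, Set.mem_singleton_iff, Sym2.eq_iff, Fin.ext_iff,
    dp_adj]
  omega

lemma dp_reflect (n i j : ℕ) (h : i + j + 2 = n) : Nonempty (dp n i ≃g dp n j) := by
  refine iso_of_inj (fun v => ⟨n - 1 - v.val, by omega⟩) ?_ ?_
  · intro u v huv
    simp only [Fin.mk.injEq] at huv
    ext; omega
  · intro u v
    simp only [dp_adj]
    omega

/-- The interval `[a, b)` in `Fin n`. -/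
def itv (n a b : ℕ) : Finset (Fin n) := Finset.univ.filter fun v => a ≤ v.val ∧ v.val < b

lemma mem_itv {n a b : ℕ} {v : Fin n} : v ∈ itv n a b ↔ a ≤ v.val ∧ v.val < b := by
  simp [itv]

lemma card_itv {n a b : ℕ} (h : b ≤ n) : (itv n a b).card = b - a := by
  rw [← Nat.card_Ico, ← Finset.card_map Fin.valEmbedding]
  congr 1
  ext x
  simp only [Finset.mem_map, mem_itv, Fin.valEmbedding_apply, Finset.mem_Ico]
  constructor
  · rintro ⟨v, hv, rfl⟩; exact hv
  · intro hx; exact ⟨⟨x, by omega⟩, hx, rfl⟩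

/-- No edge leaves `S`. -/
def Closed {V : Type} (G : SimpleGraph V) (S : Finset V) : Prop :=
  ∀ u v, G.Adj u v → u ∈ S → v ∈ S

lemma closed_dp {n k : ℕ} (hk : k + 1 < n) {S : Finset (Fin n)} (hS : Closed (dp n k) S) :
    S.card = 0 ∨ S.card = k + 1 ∨ S.card = n - k - 1 ∨ S.card = n := by
  have h1 : ∀ v : ℕ, ∀ hv : v < n, v ≤ k → ((⟨v, hv⟩ : Fin n) ∈ S ↔ (⟨0, by omega⟩ : Fin n) ∈ S) := by
    intro v
    induction v with
    | zero => intros; rfl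
    | succ v ih =>
      intro hv hvk
      rw [← ih (by omega) (by omega)]
      constructor
      · exact hS _ _ (by rw [dp_adj]; simp; omega)
      · exact hS _ _ (by rw [dp_adj]; simp; omega)
  have h2 : ∀ v : ℕ, ∀ hv : k + 1 + v < n, ((⟨k + 1 + v, hv⟩ : Fin n) ∈ S ↔
      (⟨k + 1, by omega⟩ : Fin n) ∈ S) := by
    intro v
    induction v with
    | zero => intros; rfl
    | succ v ih =>
      intro hv
      rw [← ih (by omega)]
      constructor
      · exact hS _ _ (by rw [dp_adj]; simp; omega)
      · exact hS _ _ (by rw [dp_adj]; simp; omega)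
  have h3 : ∀ v : Fin n, k < v.val → (v ∈ S ↔ (⟨k + 1, by omega⟩ : Fin n) ∈ S) := by
    intro v hv
    rw [← h2 (v.val - (k + 1)) (by omega)]
    have : (⟨k + 1 + (v.val - (k + 1)), by omega⟩ : Fin n) = v := by ext; simp; omega
    rw [this]
  have key : ∃ a b, b ≤ n ∧ S = itv n a b ∧
      (b - a = 0 ∨ b - a = k + 1 ∨ b - a = n - k - 1 ∨ b - a = n) := by
    by_cases ha : (⟨0, by omega⟩ : Fin n) ∈ S <;> by_cases hb : (⟨k + 1, by omega⟩ : Fin n) ∈ S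
    · refine ⟨0, n, by omega, ?_, by omega⟩
      ext v
      have := h1 v v.2; have := h3 v
      rw [mem_itv]
      rcases Nat.lt_or_ge k v with h | h <;> simp_all
    · refine ⟨0, k + 1, by omega, ?_, by omega⟩
      ext v
      have := h1 v v.2; have := h3 v
      rw [mem_itv]
      rcases Nat.lt_or_ge k v with h | h <;> simp_all
    · refine ⟨k + 1, n, by omega, ?_, by omega⟩
      ext v
      have := h1 v v.2; have := h3 v
      rw [mem_itv]
      rcases Nat.lt_or_ge k v with h | h <;> simp_all
    · refine ⟨0, 0, by omega, ?_, by omega⟩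
      ext v
      have := h1 v v.2; have := h3 v
      rw [mem_itv]
      rcases Nat.lt_or_ge k v with h | h <;> simp_all
  obtain ⟨a, b, hb, rfl, h⟩ := key
  rw [card_itv hb]
  exact h

lemma closed_path {n : ℕ} (hn : 0 < n) {S : Finset (Fin n)} (hS : Closed (pathGraph n) S) :
    S.card = 0 ∨ S.card = n := by
  have h1 : ∀ v : ℕ, ∀ hv : v < n, ((⟨v, hv⟩ : Fin n) ∈ S ↔ (⟨0, by omega⟩ : Fin n) ∈ S) := by
    intro v
    induction v with
    | zero => intros; rfl
    | succ v ih =>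
      intro hv
      rw [← ih (by omega)]
      constructor
      · exact hS _ _ (by rw [pathGraph_adj]; simp)
      · exact hS _ _ (by rw [pathGraph_adj]; simp)
  by_cases ha : (⟨0, by omega⟩ : Fin n) ∈ S
  · right
    have : S = Finset.univ := by ext v; have := h1 v v.2; simp_all
    rw [this]; simp
  · left
    have : S = ∅ := by ext v; have := h1 v v.2; simp_all
    rw [this]; simp

lemma closed_iso {V W : Type} {G : SimpleGraph V} {H : SimpleGraph W} (i : G ≃g H)
    {S : Finset V} (hS : Closed G S) : Closed H (S.map i.toEquiv.toEmbedding) := by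
  intro u v huv hu
  rw [Finset.mem_map_equiv] at hu ⊢
  exact hS _ _ (i.symm.map_rel_iff.mpr huv) hu

/-- Some vertex has three distinct neighbours. -/
def HasThree {V : Type} (G : SimpleGraph V) : Prop :=
  ∃ x a b c, G.Adj x a ∧ G.Adj x b ∧ G.Adj x c ∧ a ≠ b ∧ a ≠ c ∧ b ≠ c

lemma three_iso {V W : Type} {G : SimpleGraph V} {H : SimpleGraph W} (i : G ≃g H)
    (h : HasThree G) : HasThree H := by
  obtain ⟨x, a, b, c, h1, h2, h3, h4, h5, h6⟩ := h
  exact ⟨i x, i a, i b, i c, i.map_rel_iff.mpr h1, i.map_rel_iff.mpr h2, i.map_rel_iff.mpr h3,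
    i.injective.ne h4, i.injective.ne h5, i.injective.ne h6⟩

lemma not_three_path (n : ℕ) : ¬ HasThree (pathGraph n) := by
  rintro ⟨x, a, b, c, h1, h2, h3, h4, h5, h6⟩
  simp only [pathGraph_adj, ne_eq, Fin.ext_iff] at *
  omega

lemma not_three_dp (n k : ℕ) : ¬ HasThree (dp n k) := by
  rintro ⟨x, a, b, c, h1, h2, h3, h4, h5, h6⟩
  simp only [dp_adj, ne_eq, Fin.ext_iff] at *
  omega

/-- Path with edge `k` replaced by the edge `x y`. -/
def rp (n k : ℕ) (x y : Fin n) (hxy : x ≠ y) : SimpleGraph (Fin n) where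
  Adj u v := (dp n k).Adj u v ∨ (u = x ∧ v = y) ∨ (u = y ∧ v = x)
  symm := ⟨by
    intro u v h
    rcases h with h | h | h
    · exact Or.inl h.symm
    · exact Or.inr (Or.inr ⟨h.2, h.1⟩)
    · exact Or.inr (Or.inl ⟨h.2, h.1⟩)⟩
  loopless := ⟨by
    intro u h
    rcases h with h | h | h
    · exact (dp n k).loopless.irrefl u h
    · exact hxy (h.1.symm.trans h.2)
    · exact hxy (h.2.symm.trans h.1)⟩

lemma rp_adj {n k : ℕ} {x y : Fin n} {hxy : x ≠ y} {u v : Fin n} : (rp n k x y hxy).Adj u v ↔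
    (((u.val + 1 = v.val ∧ u.val ≠ k) ∨ (v.val + 1 = u.val ∧ v.val ≠ k)) ∨
      (u.val = x.val ∧ v.val = y.val) ∨ (u.val = y.val ∧ v.val = x.val)) := by
  simp only [← Fin.ext_iff]; exact Iff.rfl

/-- `H` is not the path, but has two distinct edges with the cards `i`, `j` of the path. -/
def Bad (n i j : ℕ) : Prop :=
  ∃ (H : SimpleGraph (Fin n)) (f g : Sym2 (Fin n)), f ≠ g ∧ f ∈ H.edgeSet ∧ g ∈ H.edgeSet ∧
    Nonempty (H.deleteEdges {f} ≃g dp n i) ∧ Nonempty (H.deleteEdges {g} ≃g dp n j) ∧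
    ¬ Nonempty (H ≃g pathGraph n)

lemma Bad.symm {n i j : ℕ} (h : Bad n i j) : Bad n j i := by
  obtain ⟨H, f, g, h1, h2, h3, h4, h5, h6⟩ := h
  exact ⟨H, g, f, h1.symm, h3, h2, h5, h4, h6⟩

lemma Bad.reflect {n i j i' : ℕ} (h : Bad n i j) (hi : i + i' + 2 = n) : Bad n i' j := by
  obtain ⟨H, f, g, h1, h2, h3, ⟨h4⟩, h5, h6⟩ := h
  obtain ⟨r⟩ := dp_reflect n i i' hi
  exact ⟨H, f, g, h1, h2, h3, ⟨h4.trans r⟩, h5, h6⟩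

/-- Spider. -/
lemma bad_spider (n i j : ℕ) (h : i + j + 3 < n) : Bad n i j := by
  have hxy : (⟨i, by omega⟩ : Fin n) ≠ ⟨i + j + 2, by omega⟩ := by
    simp only [ne_eq, Fin.mk.injEq]; omega
  refine ⟨rp n i ⟨i, by omega⟩ ⟨i + j + 2, by omega⟩ hxy,
    s(⟨i, by omega⟩, ⟨i + j + 2, by omega⟩), s(⟨i + j + 1, by omega⟩, ⟨i + j + 2, by omega⟩),
    ?_, ?_, ?_, ?_, ?_, ?_⟩
  · simp only [ne_eq, Sym2.eq_iff, Fin.mk.injEq]; omega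
  · rw [mem_edgeSet, rp_adj]; simp
  · rw [mem_edgeSet, rp_adj]; dsimp only; omega
  · refine iso_of_inj id Function.injective_id ?_
    intro u v
    simp only [deleteEdges_adj, rp_adj, dp_adj, Set.mem_singleton_iff, Sym2.eq_iff, Fin.ext_iff,
      id]
    omega
  · refine iso_of_inj (fun v => ⟨if v.val ≤ i then v.val + (j + 1) else
      if v.val < i + j + 2 then v.val - (i + 1) else v.val, by split_ifs <;> omega⟩) ?_ ?_
    · intro u v huv
      simp only [Fin.mk.injEq] at huv
      ext
      split_ifs at huv <;> omega
    · intro u v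
      simp only [deleteEdges_adj, rp_adj, dp_adj, Set.mem_singleton_iff, Sym2.eq_iff, Fin.ext_iff]
      split_ifs <;> omega
  · rintro ⟨r⟩
    refine not_three_path n (three_iso r ⟨⟨i + j + 2, by omega⟩, ⟨i, by omega⟩,
      ⟨i + j + 1, by omega⟩, ⟨i + j + 3, by omega⟩, ?_⟩)
    simp only [rp_adj, ne_eq, Fin.mk.injEq]
    refine ⟨?_, ?_, ?_, ?_, ?_, ?_⟩ <;> first | omega | (simp; done) | (simp; omega)

/-- Path and cycle. -/
lemma bad_cycle (n i : ℕ) (h : i + 3 < n) : Bad n i i := by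
  have hxy : (⟨i + 1, by omega⟩ : Fin n) ≠ ⟨n - 1, by omega⟩ := by
    simp only [ne_eq, Fin.mk.injEq]; omega
  refine ⟨rp n i ⟨i + 1, by omega⟩ ⟨n - 1, by omega⟩ hxy,
    s(⟨i + 1, by omega⟩, ⟨n - 1, by omega⟩), s(⟨i + 1, by omega⟩, ⟨i + 2, by omega⟩),
    ?_, ?_, ?_, ?_, ?_, ?_⟩
  · simp only [ne_eq, Sym2.eq_iff, Fin.mk.injEq]; omega
  · rw [mem_edgeSet, rp_adj]; simp
  · rw [mem_edgeSet, rp_adj]; simp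
  · refine iso_of_inj id Function.injective_id ?_
    intro u v
    simp only [deleteEdges_adj, rp_adj, dp_adj, Set.mem_singleton_iff, Sym2.eq_iff, Fin.ext_iff,
      id]
    omega
  · refine iso_of_inj (fun v => ⟨if v.val ≤ i then v.val else
      if v.val = i + 1 then n - 1 else v.val - 1, by split_ifs <;> omega⟩) ?_ ?_
    · intro u v huv
      simp only [Fin.mk.injEq] at huv
      ext
      split_ifs at huv <;> omega
    · intro u v
      simp only [deleteEdges_adj, rp_adj, dp_adj, Set.mem_singleton_iff, Sym2.eq_iff, Fin.ext_iff]
      split_ifs <;> omega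
  · rintro ⟨r⟩
    have hc : Closed (rp n i ⟨i + 1, by omega⟩ ⟨n - 1, by omega⟩ hxy) (itv n 0 (i + 1)) := by
      intro u v
      simp only [rp_adj, mem_itv]
      omega
    have := closed_path (by omega) (closed_iso r hc)
    rw [Finset.card_map, card_itv (by omega)] at this
    omega

lemma bad_of_ne (n i j : ℕ) (hn : 5 ≤ n) (ho : Odd n) (hi : i + 1 < n) (hj : j + 1 < n)
    (hij : i ≠ j) : Bad n i j := by
  obtain ⟨m, rfl⟩ := ho
  by_cases hs : i + j + 2 = 2 * m + 1
  · rcases Nat.lt_or_ge i m with h | h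
    · exact ((bad_cycle _ i (by omega)).symm.reflect hs).symm
    · exact (bad_cycle _ j (by omega)).reflect (by omega)
  · rcases Nat.lt_or_ge i m with h | h <;> rcases Nat.lt_or_ge j m with h' | h'
    · exact bad_spider _ _ _ (by omega)
    · exact ((bad_spider _ i (2 * m - 1 - j) (by omega)).symm.reflect (by omega)).symm
    · exact (bad_spider _ (2 * m - 1 - i) j (by omega)).reflect (by omega)
    · exact (((bad_spider _ (2 * m - 1 - i) (2 * m - 1 - j) (by omega)).symm.reflect
        (i' := j) (by omega)).symm.reflect (by omega))

/-- The combinatorial heart of the upper bound. -/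
lemma good (m : ℕ) (hm : 2 ≤ m) (x y p q : Fin (2 * m + 1)) (hxy : x ≠ y)
    (h2 : ((rp _ (m - 1) x y hxy).deleteEdges {s(p, q)} ≃g dp (2 * m + 1) m))
    (hpq : (rp _ (m - 1) x y hxy).Adj p q) (hne : s(p, q) ≠ s(x, y))
    (h3 : ∀ S, Closed (rp _ (m - 1) x y hxy) S → S.card = 0 ∨ S.card = 1 ∨ S.card = 2 * m ∨
      S.card = 2 * m + 1) : Nonempty (rp _ (m - 1) x y hxy ≃g pathGraph (2 * m + 1)) := by
  wlog hlt : x.val < y.val generalizing x y with W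
  · have e : rp (2 * m + 1) (m - 1) x y hxy = rp (2 * m + 1) (m - 1) y x hxy.symm := by
      ext u v; simp only [rp_adj]; omega
    rw [e] at h2 hpq h3 ⊢
    exact W y x hxy.symm h2 hpq (by rwa [Sym2.eq_swap (a := y)]) h3
      (by rw [ne_eq, Fin.ext_iff] at hxy; omega)
  wlog hpl : p.val < q.val generalizing p q with W
  · refine W q p ?_ hpq.symm (by rwa [Sym2.eq_swap]) ?_
    · rwa [Sym2.eq_swap]
    · have := hpq.ne
      rw [ne_eq, Fin.ext_iff] at this; omega
  have hsep : x.val < m ∧ m ≤ y.val := by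
    by_contra hcon
    have := h3 (itv _ 0 m) (by intro u v; simp only [rp_adj, mem_itv]; omega)
    rw [card_itv (by omega)] at this
    omega
  have hcl : ∀ a b, b ≤ 2 * m + 1 → Closed ((rp _ (m - 1) x y hxy).deleteEdges {s(p, q)})
      (itv _ a b) → b - a = 0 ∨ b - a = m ∨ b - a = m + 1 ∨ b - a = 2 * m + 1 := by
    intro a b hb hc
    have := closed_dp (by omega) (closed_iso h2 hc)
    rw [Finset.card_map, card_itv hb] at this
    omega
  simp only [rp_adj, ne_eq, Sym2.eq_iff, Fin.ext_iff] at hpq hne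
  have hq : p.val + 1 = q.val ∧ p.val ≠ m - 1 := by omega
  have hB : m ≤ p.val := by
    by_contra hcon
    rcases Nat.lt_or_ge p.val x.val with h | h
    · have := hcl 0 (p + 1) (by omega) (by
        intro u v
        simp only [deleteEdges_adj, rp_adj, mem_itv, Set.mem_singleton_iff, Sym2.eq_iff,
          Fin.ext_iff]
        omega)
      omega
    · have := hcl (p + 1) m (by omega) (by
        intro u v
        simp only [deleteEdges_adj, rp_adj, mem_itv, Set.mem_singleton_iff, Sym2.eq_iff,
          Fin.ext_iff]
        omega)
      omega
  have hY : (y.val = m ∧ p.val = m) ∨ (y.val = 2 * m ∧ q.val = 2 * m) := by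
    rcases Nat.lt_or_ge p.val y.val with h | h
    · have := hcl m (p + 1) (by omega) (by
        intro u v
        simp only [deleteEdges_adj, rp_adj, mem_itv, Set.mem_singleton_iff, Sym2.eq_iff,
          Fin.ext_iff]
        omega)
      omega
    · have := hcl (p + 1) (2 * m + 1) (by omega) (by
        intro u v
        simp only [deleteEdges_adj, rp_adj, mem_itv, Set.mem_singleton_iff, Sym2.eq_iff,
          Fin.ext_iff]
        omega)
      omega
  have hX : x.val = 0 ∨ x.val = m - 1 := by
    by_contra hcon
    refine not_three_dp _ _ (three_iso h2 ⟨x, ⟨x.val - 1, by omega⟩, ⟨x.val + 1, by omega⟩, y, ?_⟩)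
    simp only [deleteEdges_adj, rp_adj, Set.mem_singleton_iff, Sym2.eq_iff, Fin.ext_iff, ne_eq]
    refine ⟨⟨?_, ?_⟩, ⟨?_, ?_⟩, ⟨?_, ?_⟩, ?_, ?_, ?_⟩ <;> first | omega | (simp; done) | (simp; omega)
  refine iso_of_inj (fun v => ⟨if v.val < m then (if x.val = m - 1 then v.val else m - 1 - v.val)
    else (if y.val = m then v.val else 3 * m - v.val), by split_ifs <;> omega⟩) ?_ ?_
  · intro u v huv
    simp only [Fin.mk.injEq] at huv
    ext
    split_ifs at huv <;> omega
  · intro u v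
    simp only [rp_adj, pathGraph_adj]
    split_ifs <;> omega

/-- Upper bound, abstractly. -/
lemma upper (m : ℕ) (hm : 2 ≤ m) (W : Type) (H : SimpleGraph W) (f1 f2 f3 : Sym2 W)
    (m1 : f1 ∈ H.edgeSet) (m2 : f2 ∈ H.edgeSet) (h12 : f1 ≠ f2)
    (i1 : H.deleteEdges {f1} ≃g dp (2 * m + 1) (m - 1))
    (i2 : H.deleteEdges {f2} ≃g dp (2 * m + 1) m)
    (i3 : H.deleteEdges {f3} ≃g dp (2 * m + 1) 0) :
    Nonempty (H ≃g pathGraph (2 * m + 1)) := by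
  induction f1 with
  | _ a b =>
  induction f2 with
  | _ c d =>
  rw [mem_edgeSet] at m1 m2
  have hxy : i1 a ≠ i1 b := i1.injective.ne m1.ne
  have hadj : ∀ u v, (rp _ (m - 1) (i1 a) (i1 b) hxy).Adj (i1 u) (i1 v) ↔ H.Adj u v := by
    intro u v
    change (dp _ (m - 1)).Adj (i1 u) (i1 v) ∨ _ ↔ _
    rw [i1.map_adj_iff]
    simp only [deleteEdges_adj, i1.injective.eq_iff, Set.mem_singleton_iff, Sym2.eq_iff]
    constructor
    · rintro (h | ⟨rfl, rfl⟩ | ⟨rfl, rfl⟩)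
      · exact h.1
      · exact m1
      · exact m1.symm
    · intro h; tauto
  let I : H ≃g rp _ (m - 1) (i1 a) (i1 b) hxy := ⟨i1.toEquiv, fun {u v} => hadj u v⟩
  have hI : ∀ u, I u = i1 u := fun u => rfl
  let J : H.deleteEdges {s(c, d)} ≃g
      (rp _ (m - 1) (i1 a) (i1 b) hxy).deleteEdges {s(i1 c, i1 d)} :=
    ⟨i1.toEquiv, fun {u v} => by
      change ((rp _ (m - 1) (i1 a) (i1 b) hxy).deleteEdges {s(i1 c, i1 d)}).Adj (i1 u) (i1 v) ↔ _
      simp only [deleteEdges_adj, hadj, i1.injective.eq_iff, Set.mem_singleton_iff, Sym2.eq_iff]⟩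
  obtain ⟨r⟩ := good m hm (i1 a) (i1 b) (i1 c) (i1 d) hxy (J.symm.trans i2)
    ((hadj c d).mpr m2) (by
      intro h
      apply h12
      simpa only [Sym2.eq_iff, i1.injective.eq_iff, eq_comm] using h.symm) (by
      intro S hS
      have h1 := closed_iso I.symm hS
      have h2 : Closed (H.deleteEdges {f3}) (S.map I.symm.toEquiv.toEmbedding) := by
        intro u v huv
        rw [deleteEdges_adj] at huv
        exact h1 u v huv.1
      have h3 := closed_dp (by omega) (closed_iso i3 h2)
      rw [Finset.card_map, Finset.card_map] at h3
      omega)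
  exact ⟨I.trans r⟩

/-- For every odd `n ≥ 5`, the path `P_n` has edge-reconstruction number 3. -/
theorem stmt9 (n : ℕ) (hn : 5 ≤ n) (ho : Odd n) : ern (pathGraph n) = 3 := by
  classical
  have hup : 3 ∈ {k | ∃ s : Finset (Sym2 (Fin n)), s.card = k ∧
        (↑s : Set (Sym2 (Fin n))) ⊆ (pathGraph n).edgeSet ∧
        ∀ (W : Type) (_ : Fintype W) (H : SimpleGraph W) (t : Finset (Sym2 W)),
          (↑t : Set (Sym2 W)) ⊆ H.edgeSet →
          (∃ φ : {e // e ∈ s} ≃ {f // f ∈ t},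
            ∀ e : {e // e ∈ s},
              Nonempty (H.deleteEdges {(φ e).1} ≃g (pathGraph n).deleteEdges {e.1})) →
          Nonempty (H ≃g pathGraph n)} := by
    obtain ⟨m, rfl⟩ := ho
    have k1 : m - 1 + 1 < 2 * m + 1 := by omega
    have k2 : m + 1 < 2 * m + 1 := by omega
    have k3 : 0 + 1 < 2 * m + 1 := by omega
    have n12 : pe _ _ k1 ≠ pe _ _ k2 := fun h => by have := pe_inj _ _ h; omega
    have n13 : pe _ _ k1 ≠ pe _ _ k3 := fun h => by have := pe_inj _ _ h; omega
    have n23 : pe _ _ k2 ≠ pe _ _ k3 := fun h => by have := pe_inj _ _ h; omega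
    refine ⟨{pe _ _ k1, pe _ _ k2, pe _ _ k3}, Finset.card_eq_three.mpr
      ⟨_, _, _, n12, n13, n23, rfl⟩, ?_, ?_⟩
    · intro e he
      simp only [Finset.coe_insert, Finset.coe_singleton, Set.mem_insert_iff,
        Set.mem_singleton_iff] at he
      rcases he with rfl | rfl | rfl <;> exact pe_mem _ _ _
    · rintro W _ H t ht ⟨φ, hφ⟩
      obtain ⟨i1⟩ := hφ ⟨pe _ _ k1, by simp⟩
      obtain ⟨i2⟩ := hφ ⟨pe _ _ k2, by simp⟩
      obtain ⟨i3⟩ := hφ ⟨pe _ _ k3, by simp⟩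
      rw [del_pe] at i1 i2 i3
      refine upper m (by omega) W H _ _ _ (ht (φ _).2) (ht (φ _).2) ?_ i1 i2 i3
      intro h
      have := φ.injective (Subtype.ext h)
      exact n12 (congrArg Subtype.val this)
  refine le_antisymm (Nat.sInf_le hup) ?_
  · have hne : ∀ k, k < 3 → ¬ ∃ s : Finset (Sym2 (Fin n)), s.card = k ∧
        (↑s : Set (Sym2 (Fin n))) ⊆ (pathGraph n).edgeSet ∧
        ∀ (W : Type) (_ : Fintype W) (H : SimpleGraph W) (t : Finset (Sym2 W)),
          (↑t : Set (Sym2 W)) ⊆ H.edgeSet →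
          (∃ φ : {e // e ∈ s} ≃ {f // f ∈ t},
            ∀ e : {e // e ∈ s},
              Nonempty (H.deleteEdges {(φ e).1} ≃g (pathGraph n).deleteEdges {e.1})) →
          Nonempty (H ≃g pathGraph n) := by
      rintro k hk ⟨s, hs, hsub, hall⟩
      have hpair : ∃ i j, ∃ (hi : i + 1 < n) (hj : j + 1 < n), i ≠ j ∧
          ∀ e ∈ s, e = pe n i hi ∨ e = pe n j hj := by
        have hc : s.card = 0 ∨ s.card = 1 ∨ s.card = 2 := by omega
        rcases hc with h | h | h
        · rw [Finset.card_eq_zero] at h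
          exact ⟨0, 1, by omega, by omega, by omega, by simp [h]⟩
        · obtain ⟨e, rfl⟩ := Finset.card_eq_one.mp h
          obtain ⟨i, hi, rfl⟩ := exists_pe (hsub (by simp : e ∈ _))
          by_cases h0 : i = 0
          · exact ⟨i, 1, hi, by omega, by omega, by simp⟩
          · exact ⟨i, 0, hi, by omega, by omega, by simp⟩
        · obtain ⟨e, f, hef, rfl⟩ := Finset.card_eq_two.mp h
          obtain ⟨i, hi, rfl⟩ := exists_pe (hsub (by simp : e ∈ _))
          obtain ⟨j, hj, rfl⟩ := exists_pe (hsub (by simp : f ∈ _))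
          exact ⟨i, j, hi, hj, fun h => hef (by subst h; rfl), by simp⟩
      obtain ⟨i, j, hi, hj, hij, hmem⟩ := hpair
      obtain ⟨H, f, g, hfg, hf, hg, h1, h2, hnot⟩ := bad_of_ne n i j hn ho hi hj hij
      have hpp : pe n j hj ≠ pe n i hi := fun h => hij (pe_inj _ _ h).symm
      let F : Sym2 (Fin n) → Sym2 (Fin n) := fun e => if e = pe n i hi then f else g
      have Fi : F (pe n i hi) = f := if_pos rfl
      have Fj : F (pe n j hj) = g := if_neg hpp
      apply hnot
      refine hall (Fin n) inferInstance H (s.image F) ?_ ?_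
      · intro e he
        simp only [Finset.coe_image, Set.mem_image, Finset.mem_coe] at he
        obtain ⟨e', he', rfl⟩ := he
        rcases hmem e' he' with rfl | rfl
        · rwa [Fi]
        · rwa [Fj]
      · refine ⟨Equiv.ofBijective
          (fun e => ⟨F e.1, Finset.mem_image_of_mem F e.2⟩) ⟨?_, ?_⟩, ?_⟩
        · rintro ⟨e, he⟩ ⟨e', he'⟩ h
          have h' : F e = F e' := congrArg Subtype.val h
          apply Subtype.ext
          change e = e'
          rcases hmem e he with rfl | rfl <;> rcases hmem e' he' with rfl | rfl
          · rfl
          · rw [Fi, Fj] at h'; exact absurd h' hfg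
          · rw [Fi, Fj] at h'; exact absurd h'.symm hfg
          · rfl
        · rintro ⟨e, he⟩
          obtain ⟨e', he', rfl⟩ := Finset.mem_image.mp he
          exact ⟨⟨e', he'⟩, rfl⟩
        · rintro ⟨e, he⟩
          change Nonempty (H.deleteEdges {F e} ≃g (pathGraph n).deleteEdges {e})
          rcases hmem e he with rfl | rfl
          · rw [Fi, del_pe]; exact h1
          · rw [Fj, del_pe]; exact h2
    by_contra hlt
    push Not at hlt
    exact hne _ hlt (Nat.sInf_mem ⟨3, hup⟩)

end ErnPaper
end
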